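/- arXiv:2201.04511 — 2 statements merged into one kernel-verified Lean document; each statement's English description precedes it below -/
import Mathlib

section
/- Let $a \in L_1(\mathbb{R}^d)$ with $a(-x)=\overline{a(x)}$, $V$ real continuous vanishing at infinity, $x_0$ a global minimum point of $V$ with $V_{\min} = V(x_0) \le a_{\min} = \inf \mathcal{F}[a]$. If there exists $\delta > 0$ such that $\int_{Q_2(0)} \prod_{i=1}^d (1-|x_i|)\, \mathrm{Re}\, a(\delta x)\,dx + \delta^{-d}\int_{Q_1(0)} (V(x_0 + \delta x) - V_{\min})\,dx < 0$, then the operator $\mathcal{L} = \mathcal{L}_{a\star} + \mathcal{L}_V$ has at least one eigenvalue strictly below $V_{\min}$. -/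
open MeasureTheory

/-- The open cube of side `r` centered at `x0` in `ℝ^d`. -/
def cube (d : ℕ) (r : ℝ) (x0 : Fin d → ℝ) : Set (Fin d → ℝ) :=
  {x | ∀ i, |x i - x0 i| < r / 2}

/-- For a positive operator `B`, the quadratic form of `B` controls `‖B u‖ ^ 2`. -/
theorem norm_sq_apply_le_of_nonneg {H : Type*} [NormedAddCommGroup H] [InnerProductSpace ℂ H]
    (B : H →L[ℂ] H) (hsymm : ∀ u v, inner ℂ (B u) v = inner ℂ u (B v))
    (hpos : ∀ u, 0 ≤ (inner ℂ (B u) u).re) (u : H) :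
    ‖B u‖ ^ 2 ≤ (‖B‖ + 1) * (inner ℂ (B u) u).re := by
  have hB : 0 < ‖B‖ + 1 := by positivity
  have h := hpos ((‖B‖ + 1 : ℂ) • u - B u)
  have e1 : inner ℂ (B ((‖B‖ + 1 : ℂ) • u - B u)) ((‖B‖ + 1 : ℂ) • u - B u)
      = (((‖B‖ + 1) ^ 2 : ℝ) : ℂ) * inner ℂ (B u) u
        - ((2 * (‖B‖ + 1) * ‖B u‖ ^ 2 : ℝ) : ℂ) + inner ℂ (B (B u)) (B u) := by
    have e2 : inner ℂ (B (B u)) u = ((‖B u‖ ^ 2 : ℝ) : ℂ) := by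
      rw [hsymm, inner_self_eq_norm_sq_to_K]; simp
    have e3 : inner ℂ (B u) (B u) = ((‖B u‖ ^ 2 : ℝ) : ℂ) := by
      rw [inner_self_eq_norm_sq_to_K]; simp
    simp only [map_sub, map_smul, inner_sub_left, inner_sub_right, inner_smul_left,
      inner_smul_right, e2, e3, map_add, Complex.conj_ofReal, map_one]
    push_cast
    ring
  rw [e1] at h
  have h2 : (inner ℂ (B (B u)) (B u)).re ≤ ‖B‖ * ‖B u‖ ^ 2 := by
    calc _ ≤ ‖inner ℂ (B (B u)) (B u)‖ := Complex.re_le_norm _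
      _ ≤ ‖B (B u)‖ * ‖B u‖ := norm_inner_le_norm _ _
      _ ≤ (‖B‖ * ‖B u‖) * ‖B u‖ := by gcongr; exact B.le_opNorm _
      _ = _ := by ring
  rw [Complex.add_re, Complex.sub_re, Complex.re_ofReal_mul, Complex.ofReal_re] at h
  have h3 : 0 ≤ (‖B‖ + 1) * ((‖B‖ + 1) * (inner ℂ (B u) u).re - ‖B u‖ ^ 2) := by
    nlinarith [sq_nonneg ‖B u‖]
  nlinarith [nonneg_of_mul_nonneg_right h3 hB]

theorem mul_norm_le_norm_sub_smul {H : Type*} [NormedAddCommGroup H] [InnerProductSpace ℂ H]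
    (A : H →L[ℂ] H) {v : ℝ} (hA : ∀ u, v * ‖u‖ ^ 2 ≤ (inner ℂ (A u) u).re) (l : ℝ) (u : H) :
    (v - l) * ‖u‖ ≤ ‖A u - (l : ℂ) • u‖ := by
  rcases eq_or_ne u 0 with rfl | hu
  · simp
  have hu' : 0 < ‖u‖ := norm_pos_iff.2 hu
  refine le_of_mul_le_mul_right ?_ hu'
  calc (v - l) * ‖u‖ * ‖u‖ = v * ‖u‖ ^ 2 - l * ‖u‖ ^ 2 := by ring
    _ ≤ (inner ℂ (A u) u).re - l * ‖u‖ ^ 2 := by gcongr; exact hA u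
    _ = (inner ℂ (A u - (l : ℂ) • u) u).re := by
      rw [inner_sub_left, inner_smul_left, inner_self_eq_norm_sq_to_K, Complex.sub_re,
        Complex.conj_ofReal, Complex.re_ofReal_mul]
      norm_cast
    _ ≤ ‖inner ℂ (A u - (l : ℂ) • u) u‖ := Complex.re_le_norm _
    _ ≤ _ := norm_inner_le_norm _ _

open Filter Topology in
/-- Let `A` and `M` be symmetric operators bounded below by `v ≤ 0`, with `A * M` compact. If the
quadratic form of `A + M` drops below `v`, then `A + M` has an eigenvalue below `v`. -/
theorem exists_eigenvalue_lt_of_isCompactOperator_comp {H : Type*} [NormedAddCommGroup H]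
    [InnerProductSpace ℂ H] [CompleteSpace H] (A M : H →L[ℂ] H) {v : ℝ} (hv : v ≤ 0)
    (hAs : ∀ u w, inner ℂ (A u) w = inner ℂ u (A w))
    (hMs : ∀ u w, inner ℂ (M u) w = inner ℂ u (M w))
    (hA : ∀ u, v * ‖u‖ ^ 2 ≤ (inner ℂ (A u) u).re)
    (hM : ∀ u, v * ‖u‖ ^ 2 ≤ (inner ℂ (M u) u).re)
    (hK : IsCompactOperator (A ∘L M)) {f : H}
    (hf : (inner ℂ (A f + M f) f).re < v * ‖f‖ ^ 2) :
    ∃ E : ℝ, E < v ∧ ∃ φ : H, φ ≠ 0 ∧ A φ + M φ = (E : ℂ) • φ := by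
  set T : H →L[ℂ] H := A + M with hT
  have hTs : ∀ u w, inner ℂ (T u) w = inner ℂ u (T w) := fun u w => by
    rw [hT, add_apply, add_apply, inner_add_left, inner_add_right, hAs, hMs]
  have hf0 : f ≠ 0 := by rintro rfl; simp at hf
  set q : H → ℝ := fun u => (inner ℂ (T u) u).re with hq
  set S : Set ℝ := q '' Metric.sphere 0 1 with hS
  have hbdd : BddBelow S := by
    refine ⟨-‖T‖, ?_⟩
    rintro _ ⟨u, hu, rfl⟩
    have hu1 : ‖u‖ = 1 := by simpa using hu
    have h1 : ‖inner ℂ (T u) u‖ ≤ ‖T‖ := by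
      calc _ ≤ ‖T u‖ * ‖u‖ := norm_inner_le_norm _ _
        _ ≤ (‖T‖ * ‖u‖) * ‖u‖ := by gcongr; exact T.le_opNorm _
        _ = _ := by simp [hu1]
    exact (abs_le.1 ((Complex.abs_re_le_norm _).trans h1)).1
  have hqs : ∀ (c : ℝ) u, q ((c : ℂ) • u) = c ^ 2 * q u := fun c u => by
    simp only [hq, map_smul, inner_smul_left, inner_smul_right, Complex.conj_ofReal,
      Complex.re_ofReal_mul]
    ring
  have hnorm : ∀ u : H, u ≠ 0 → ((‖u‖⁻¹ : ℝ) : ℂ) • u ∈ Metric.sphere (0 : H) 1 := fun u hu => by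
    have : ‖u‖ ≠ 0 := norm_ne_zero_iff.2 hu
    simp [norm_smul, this]
  have hSne : S.Nonempty := ⟨_, _, hnorm f hf0, rfl⟩
  set l := sInf S with hl
  have hlb : ∀ u, l * ‖u‖ ^ 2 ≤ q u := fun u => by
    rcases eq_or_ne u 0 with rfl | hu
    · simp [hq]
    have h1 := csInf_le hbdd ⟨_, hnorm u hu, rfl⟩
    have hu' : 0 < ‖u‖ := norm_pos_iff.2 hu
    rw [hqs] at h1
    calc l * ‖u‖ ^ 2 ≤ (‖u‖⁻¹ ^ 2 * q u) * ‖u‖ ^ 2 := by gcongr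
      _ = q u := by field_simp
  have hlv : l < v := by
    have hf' : 0 < ‖f‖ ^ 2 := by have := norm_pos_iff.2 hf0; positivity
    exact lt_of_mul_lt_mul_right ((hlb f).trans_lt hf) hf'.le
  have hl0 : l ≠ 0 := (hlv.trans_le hv).ne
  set B : H →L[ℂ] H := T - (l : ℂ) • ContinuousLinearMap.id ℂ H with hB
  have hBa : ∀ u, B u = T u - (l : ℂ) • u := fun u => rfl
  have hBs : ∀ u w, inner ℂ (B u) w = inner ℂ u (B w) := fun u w => by
    rw [hBa, hBa, inner_sub_left, inner_sub_right, inner_smul_left, inner_smul_right, hTs,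
      Complex.conj_ofReal]
  have hBq : ∀ u, (inner ℂ (B u) u).re = q u - l * ‖u‖ ^ 2 := fun u => by
    rw [hBa, inner_sub_left, inner_smul_left, inner_self_eq_norm_sq_to_K, Complex.sub_re,
        Complex.conj_ofReal, Complex.re_ofReal_mul]
    norm_cast
  obtain ⟨s, -, hs_lim, hsS⟩ := exists_seq_tendsto_sInf hSne hbdd
  choose φ hφ hφs using hsS
  have hφ1 : ∀ n, ‖φ n‖ = 1 := fun n => by simpa using hφ n
  have hBφ : Tendsto (fun n => B (φ n)) atTop (𝓝 0) := by
    have h1 : Tendsto (fun n => (‖B‖ + 1) * (s n - l)) atTop (𝓝 0) := by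
      simpa [← hl] using (hs_lim.sub_const l).const_mul (‖B‖ + 1)
    have h2 : Tendsto (fun n => ‖B (φ n)‖ ^ 2) atTop (𝓝 0) := by
      refine squeeze_zero (fun n => by positivity) (fun n => ?_) h1
      have := norm_sq_apply_le_of_nonneg B hBs (fun u => by rw [hBq]; linarith [hlb u]) (φ n)
      rwa [hBq, hφ1, hφs, one_pow, mul_one] at this
    rw [tendsto_zero_iff_norm_tendsto_zero]
    simpa [Real.sqrt_sq] using h2.sqrt
  have hcpt := hK.isCompact_closure_image_closedBall (f := ((A ∘L M : H →L[ℂ] H) : H →ₗ[ℂ] H)) 1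
  obtain ⟨z, -, n, hn, hz⟩ := hcpt.tendsto_subseq (x := fun k => (A ∘L M) (φ k))
    (fun k => subset_closure ⟨φ k, by simp [hφ1], rfl⟩)
  have hfac : ∀ u, A (M u - (l : ℂ) • u) - (l : ℂ) • (M u - (l : ℂ) • u)
      = A (M u) - (l : ℂ) • B u := fun u => by
    simp only [hBa, hT, map_sub, map_smul, smul_sub, smul_add, add_apply]
    abel
  have hlow : ∀ u, (v - l) ^ 2 * ‖u‖ ≤ ‖A (M u) - (l : ℂ) • B u‖ := fun u => by
    rw [← hfac]
    have h1 := mul_norm_le_norm_sub_smul A hA l (M u - (l : ℂ) • u)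
    have h2 := mul_norm_le_norm_sub_smul M hM l u
    have h3 : 0 < v - l := by linarith
    nlinarith
  have hconv : Tendsto (fun k => A (M (φ (n k))) - (l : ℂ) • B (φ (n k))) atTop (𝓝 z) := by
    simpa using hz.sub ((hBφ.comp hn.tendsto_atTop).const_smul (l : ℂ))
  have hanti : CauchySeq (fun k => φ (n k)) := by
    have hc := hconv.cauchySeq
    rw [Metric.cauchySeq_iff] at hc ⊢
    intro ε hε
    have h3 : 0 < (v - l) ^ 2 := by have : 0 < v - l := by linarith
                                    positivity
    obtain ⟨N, hN⟩ := hc ((v - l) ^ 2 * ε) (by positivity)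
    refine ⟨N, fun i hi j hj => ?_⟩
    have h4 := hN i hi j hj
    rw [dist_eq_norm] at h4 ⊢
    refine lt_of_mul_lt_mul_left ((hlow _).trans_lt ?_) h3.le
    rw [map_sub, map_sub, map_sub, smul_sub, sub_sub_sub_comm]
    exact h4
  obtain ⟨ψ, hψ⟩ := cauchySeq_tendsto_of_complete hanti
  have hψ1 : ‖ψ‖ = 1 := tendsto_nhds_unique hψ.norm (by simp [hφ1])
  have hBψ : B ψ = 0 :=
    tendsto_nhds_unique ((B.continuous.tendsto ψ).comp hψ) (hBφ.comp hn.tendsto_atTop)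
  refine ⟨l, hlv, ψ, ?_, ?_⟩
  · rintro rfl; simp at hψ1
  · exact sub_eq_zero.1 hBψ

theorem Lp_two_norm_sq_eq_integral {X : Type*} [MeasurableSpace X] {μ : Measure X}
    (f : Lp ℂ 2 μ) : ‖f‖ ^ 2 = ∫ x, ‖f x‖ ^ 2 ∂μ := by
  have h : inner ℂ f f = ((∫ x, ‖f x‖ ^ 2 ∂μ : ℝ) : ℂ) := by
    rw [L2.inner_def, ← integral_complex_ofReal]
    congr 1 with x
    rw [inner_self_eq_norm_sq_to_K]
    simp
  refine Complex.ofReal_injective ?_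
  rw [← h, inner_self_eq_norm_sq_to_K]
  simp

theorem Lp_two_integrable_norm_sq {X : Type*} [MeasurableSpace X] {μ : Measure X}
    (f : Lp ℂ 2 μ) : Integrable (fun x => ‖f x‖ ^ 2) μ :=
  (memLp_two_iff_integrable_sq_norm (Lp.aestronglyMeasurable f)).1 (Lp.memLp f)

/-- A linear transformation of functions which is bounded in the `L²` norm induces a continuous
linear map on `L²`. -/
theorem exists_clm_Lp_two_of_bound {X : Type*} [MeasurableSpace X] {μ : Measure X}
    (F : (X → ℂ) → X → ℂ) {C : ℝ} (hC : 0 ≤ C)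
    (hmeas : ∀ u : Lp ℂ 2 μ, AEStronglyMeasurable (F u) μ)
    (hint : ∀ u : Lp ℂ 2 μ, Integrable (fun x => ‖F u x‖ ^ 2) μ)
    (hbound : ∀ u : Lp ℂ 2 μ, ∫ x, ‖F u x‖ ^ 2 ∂μ ≤ C ^ 2 * ‖u‖ ^ 2)
    (hadd : ∀ u v : Lp ℂ 2 μ, F (u + v : Lp ℂ 2 μ) =ᵐ[μ] fun x => F u x + F v x)
    (hsmul : ∀ (c : ℂ) (u : Lp ℂ 2 μ), F (c • u : Lp ℂ 2 μ) =ᵐ[μ] fun x => c * F u x) :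
    ∃ A : Lp ℂ 2 μ →L[ℂ] Lp ℂ 2 μ, ‖A‖ ≤ C ∧ ∀ u : Lp ℂ 2 μ, A u =ᵐ[μ] F u := by
  have hmem : ∀ u : Lp ℂ 2 μ, MemLp (F u) 2 μ := fun u =>
    (memLp_two_iff_integrable_sq_norm (hmeas u)).2 (hint u)
  let L : Lp ℂ 2 μ →ₗ[ℂ] Lp ℂ 2 μ :=
    { toFun := fun u => (hmem u).toLp (F u)
      map_add' := fun u v => by
        ext1
        filter_upwards [(hmem (u + v)).coeFn_toLp, (hmem u).coeFn_toLp, (hmem v).coeFn_toLp,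
          Lp.coeFn_add ((hmem u).toLp (F u)) ((hmem v).toLp (F v)), hadd u v] with x h1 h2 h3 h4 h5
        rw [h1, h4, h5, Pi.add_apply, h2, h3]
      map_smul' := fun c u => by
        ext1
        filter_upwards [(hmem (c • u)).coeFn_toLp, (hmem u).coeFn_toLp,
          Lp.coeFn_smul c ((hmem u).toLp (F u)), hsmul c u] with x h1 h2 h3 h4
        rw [h1, RingHom.id_apply, h3, h4, Pi.smul_apply, h2, smul_eq_mul] }
  have hL : ∀ u, ‖L u‖ ≤ C * ‖u‖ := fun u => by
    refine le_of_sq_le_sq ?_ (by positivity)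
    rw [Lp_two_norm_sq_eq_integral, mul_pow]
    refine le_trans (le_of_eq (integral_congr_ae ?_)) (hbound u)
    filter_upwards [(hmem u).coeFn_toLp] with x hx
    exact congrArg (fun z : ℂ => ‖z‖ ^ 2) hx
  exact ⟨L.mkContinuous C hL, L.mkContinuous_norm_le hC hL, fun u => (hmem u).coeFn_toLp⟩

/-- The multiplication operator on `L²` by a bounded function. -/
theorem exists_mul_clm {X : Type*} [MeasurableSpace X] {μ : Measure X} {w : X → ℂ}
    (hw : AEStronglyMeasurable w μ) {C : ℝ} (hC : 0 ≤ C) (hwC : ∀ x, ‖w x‖ ≤ C) :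
    ∃ A : Lp ℂ 2 μ →L[ℂ] Lp ℂ 2 μ, ‖A‖ ≤ C ∧ ∀ u : Lp ℂ 2 μ, A u =ᵐ[μ] fun x => w x * u x := by
  have hle : ∀ (u : Lp ℂ 2 μ) x, ‖w x * u x‖ ^ 2 ≤ C ^ 2 * ‖u x‖ ^ 2 := fun u x => by
    rw [norm_mul, mul_pow]
    gcongr
    exact hwC x
  have hm : ∀ u : Lp ℂ 2 μ, AEStronglyMeasurable (fun x => w x * u x) μ := fun u =>
    hw.mul (Lp.aestronglyMeasurable u)
  have hi : ∀ u : Lp ℂ 2 μ, Integrable (fun x => ‖w x * u x‖ ^ 2) μ := fun u =>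
    ((Lp_two_integrable_norm_sq u).const_mul (C ^ 2)).mono' ((hm u).norm.pow 2)
      (.of_forall fun x => by simpa using hle u x)
  refine exists_clm_Lp_two_of_bound (fun u x => w x * u x) hC hm hi (fun u => ?_) (fun u v => ?_)
    (fun c u => ?_)
  · rw [Lp_two_norm_sq_eq_integral, ← integral_const_mul]
    exact integral_mono (hi u) ((Lp_two_integrable_norm_sq u).const_mul _) (hle u)
  · filter_upwards [Lp.coeFn_add u v] with x hx
    rw [hx, Pi.add_apply, mul_add]
  · filter_upwards [Lp.coeFn_smul c u] with x hx
    rw [hx, Pi.smul_apply, smul_eq_mul, mul_left_comm]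

theorem integrable_mul_of_integrable_mul_sq {X : Type*} [MeasurableSpace X] {μ : Measure X}
    {w g : X → ℝ} (hw0 : ∀ x, 0 ≤ w x) (hg : AEStronglyMeasurable g μ) (hw : Integrable w μ)
    (hwg : Integrable (fun x => w x * g x ^ 2) μ) : Integrable (fun x => w x * g x) μ := by
  refine (hw.add hwg).mono' (hw.aestronglyMeasurable.mul hg) (.of_forall fun x => ?_)
  rw [Real.norm_eq_abs, abs_mul, abs_of_nonneg (hw0 x), Pi.add_apply]
  have : |g x| ≤ 1 + g x ^ 2 := by
    rw [← sq_abs]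
    nlinarith [sq_nonneg (|g x| - 1)]
  nlinarith [hw0 x]

/-- The Cauchy-Schwarz inequality with an integrable weight. -/
theorem sq_integral_mul_le {X : Type*} [MeasurableSpace X] {μ : Measure X}
    {w g : X → ℝ} (hw0 : ∀ x, 0 ≤ w x) (hg : AEStronglyMeasurable g μ) (hw : Integrable w μ)
    (hwg : Integrable (fun x => w x * g x ^ 2) μ) :
    (∫ x, w x * g x ∂μ) ^ 2 ≤ (∫ x, w x ∂μ) * ∫ x, w x * g x ^ 2 ∂μ := by
  have h1 := integrable_mul_of_integrable_mul_sq hw0 hg hw hwg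
  have h : ∀ t : ℝ, 0 ≤ (∫ x, w x ∂μ) * (t * t) + (-2 * ∫ x, w x * g x ∂μ) * t +
      ∫ x, w x * g x ^ 2 ∂μ := fun t => by
    have h2 : 0 ≤ ∫ x, ((w x * (t * t) + w x * g x * (-2 * t)) + w x * g x ^ 2) ∂μ :=
      integral_nonneg fun x => by
        have : 0 ≤ w x * (t - g x) ^ 2 := mul_nonneg (hw0 x) (sq_nonneg _)
        simp only [Pi.zero_apply]
        linarith
    have h3 : Integrable (fun x => w x * (t * t) + w x * g x * (-2 * t)) μ :=
      (hw.mul_const _).add (h1.mul_const _)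
    rw [integral_add h3 hwg,
      integral_add (hw.mul_const _) (h1.mul_const _), integral_mul_const, integral_mul_const] at h2
    linarith
  have := discrim_le_zero h
  rw [discrim] at this
  linarith

/-- If `b` is integrable and `u` is in `L²`, then the integrand of the convolution of `b` and `u`
is integrable almost everywhere. -/
theorem ae_integrable_sub_mul {d : ℕ} {b : (Fin d → ℝ) → ℂ} (hb : Integrable b)
    (u : Lp ℂ 2 (volume : Measure (Fin d → ℝ))) :
    ∀ᵐ x, Integrable (fun y => ‖b (x - y)‖ * ‖u y‖ ^ 2) ∧ Integrable (fun y => b (x - y) * u y) := by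
  filter_upwards [(Lp_two_integrable_norm_sq u).ae_convolution_exists (.mul ℝ ℝ) hb.norm] with x hx
  have h1 : Integrable (fun y => ‖b (x - y)‖ * ‖u y‖ ^ 2) := by
    simpa [ConvolutionExistsAt, mul_comm] using hx
  refine ⟨h1, ?_⟩
  have hbx : Integrable (fun y => b (x - y)) := hb.comp_sub_left x
  refine (integrable_norm_iff (hbx.aestronglyMeasurable.mul (Lp.aestronglyMeasurable u))).1 ?_
  simpa using integrable_mul_of_integrable_mul_sq (fun y => norm_nonneg (b (x - y)))
    (Lp.aestronglyMeasurable u).norm hbx.norm h1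

/-- **Young's inequality** for the convolution operator on `L²` with an integrable kernel. -/
theorem exists_conv_clm {d : ℕ} {b : (Fin d → ℝ) → ℂ} (hb : Integrable b) :
    ∃ A : Lp ℂ 2 (volume : Measure (Fin d → ℝ)) →L[ℂ] Lp ℂ 2 (volume : Measure (Fin d → ℝ)),
      ‖A‖ ≤ ∫ x, ‖b x‖ ∧
      ∀ u : Lp ℂ 2 (volume : Measure (Fin d → ℝ)), A u =ᵐ[volume] fun x => ∫ y, b (x - y) * u y := by
  have hm : ∀ u : Lp ℂ 2 (volume : Measure (Fin d → ℝ)),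
      AEStronglyMeasurable (fun x => ∫ y, b (x - y) * u y) := fun u => by
    have := ((Lp.aestronglyMeasurable u).convolution_integrand (.mul ℂ ℂ)
      hb.aestronglyMeasurable (μ := volume)).integral_prod_right'
    simpa [mul_comm] using this
  have hconv : ∀ u : Lp ℂ 2 (volume : Measure (Fin d → ℝ)),
      Integrable (fun x => ∫ y, ‖b (x - y)‖ * ‖u y‖ ^ 2) ∧
      ∫ x, ∫ y, ‖b (x - y)‖ * ‖u y‖ ^ 2 = (∫ x, ‖b x‖) * ‖u‖ ^ 2 := fun u => by
    constructor
    · have := (Lp_two_integrable_norm_sq u).integrable_convolution (.mul ℝ ℝ) hb.norm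
      exact this.congr (.of_forall fun x => by simp [convolution, mul_comm])
    · have := integral_convolution (.mul ℝ ℝ) (Lp_two_integrable_norm_sq u) hb.norm
      rw [Lp_two_norm_sq_eq_integral]
      simpa [convolution, mul_comm] using this
  have hle : ∀ u : Lp ℂ 2 (volume : Measure (Fin d → ℝ)), ∀ᵐ x,
      ‖∫ y, b (x - y) * u y‖ ^ 2 ≤ (∫ x, ‖b x‖) * ∫ y, ‖b (x - y)‖ * ‖u y‖ ^ 2 := fun u => by
    filter_upwards [ae_integrable_sub_mul hb u] with x hx
    calc ‖∫ y, b (x - y) * u y‖ ^ 2 ≤ (∫ y, ‖b (x - y)‖ * ‖u y‖) ^ 2 := by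
          gcongr
          exact (norm_integral_le_integral_norm _).trans_eq (by simp)
      _ ≤ (∫ y, ‖b (x - y)‖) * ∫ y, ‖b (x - y)‖ * ‖u y‖ ^ 2 :=
          sq_integral_mul_le (fun y => norm_nonneg _) (Lp.aestronglyMeasurable u).norm
            (hb.comp_sub_left x).norm hx.1
      _ = _ := by rw [integral_sub_left_eq_self (fun y => ‖b y‖)]
  have hi : ∀ u : Lp ℂ 2 (volume : Measure (Fin d → ℝ)),
      Integrable (fun x => ‖∫ y, b (x - y) * u y‖ ^ 2) := fun u =>
    ((hconv u).1.const_mul (∫ x, ‖b x‖)).mono' ((hm u).norm.pow 2) (by simpa using hle u)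
  refine exists_clm_Lp_two_of_bound (fun u x => ∫ y, b (x - y) * u y)
    (integral_nonneg fun _ => norm_nonneg _) hm hi (fun u => ?_) (fun u v => ?_) (fun c u => ?_)
  · calc _ ≤ ∫ x, (∫ x, ‖b x‖) * ∫ y, ‖b (x - y)‖ * ‖u y‖ ^ 2 :=
          integral_mono_ae (hi u) ((hconv u).1.const_mul _) (hle u)
      _ = _ := by rw [integral_const_mul, (hconv u).2]; ring
  · filter_upwards [ae_integrable_sub_mul hb u, ae_integrable_sub_mul hb v] with x hu hv
    rw [← integral_add hu.2 hv.2]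
    refine integral_congr_ae ?_
    filter_upwards [Lp.coeFn_add u v] with y hy
    rw [hy, Pi.add_apply, mul_add]
  · refine .of_forall fun x => ?_
    simp only
    rw [← integral_const_mul]
    refine integral_congr_ae ?_
    filter_upwards [Lp.coeFn_smul c u] with y hy
    rw [hy, Pi.smul_apply, smul_eq_mul, mul_left_comm]

open Filter Topology in
/-- In a separable Hilbert space, bounded sequences have weakly convergent subsequences. -/
theorem exists_weakly_tendsto_subseq {H : Type*} [NormedAddCommGroup H]
    [InnerProductSpace ℂ H] [CompleteSpace H] [TopologicalSpace.SeparableSpace H]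
    {r : ℝ} {u : ℕ → H} (hu : ∀ n, ‖u n‖ ≤ r) :
    ∃ v : H, ‖v‖ ≤ r ∧ ∃ n : ℕ → ℕ, StrictMono n ∧
      ∀ z, Tendsto (fun k => inner ℂ z (u (n k))) atTop (𝓝 (inner ℂ z v)) := by
  obtain ⟨ψ, hψ, n, hn, hlim⟩ := WeakDual.isSeqCompact_closedBall ℂ H 0 r
    (x := fun k => StrongDual.toWeakDual (InnerProductSpace.toDual ℂ H (u k)))
    (fun k => by simpa using hu k)
  refine ⟨(InnerProductSpace.toDual ℂ H).symm (WeakDual.toStrongDual ψ), ?_, n, hn, fun z => ?_⟩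
  · simpa using hψ
  · have h1 := ((WeakDual.eval_continuous z).tendsto ψ).comp hlim
    have h2 := (Complex.continuous_conj.tendsto _).comp h1
    rw [← inner_conj_symm, InnerProductSpace.toDual_symm_apply]
    refine h2.congr fun k => ?_
    simp

open Filter Topology in
/-- An operator on `L²` with a square integrable kernel is compact. -/
theorem isCompactOperator_of_kernel {X : Type*} [MeasurableSpace X] {μ : Measure X}
    [TopologicalSpace.SeparableSpace (Lp ℂ 2 μ)] (K : Lp ℂ 2 μ →L[ℂ] Lp ℂ 2 μ)
    (g : X → Lp ℂ 2 μ) {D : X → ℝ} (hD : Integrable (fun x => D x ^ 2) μ)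
    (hg : ∀ x, ‖g x‖ ≤ D x) (hK : ∀ u : Lp ℂ 2 μ, K u =ᵐ[μ] fun x => inner ℂ (g x) u) :
    IsCompactOperator K := by
  have hcomp : IsCompact (K '' Metric.closedBall 0 1) := by
    refine IsSeqCompact.isCompact fun y hy => ?_
    choose u hu huy using hy
    obtain ⟨v, hv, n, hn, hlim⟩ := exists_weakly_tendsto_subseq (r := 1) (u := u)
      (fun k => by simpa using hu k)
    refine ⟨K v, ⟨v, by simpa using hv, rfl⟩, n, hn, ?_⟩
    have hsq : Tendsto (fun k => ∫ x, ‖K (u (n k) - v) x‖ ^ 2 ∂μ) atTop (𝓝 (∫ _, (0 : ℝ) ∂μ)) := by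
      refine tendsto_integral_of_dominated_convergence (fun x => 4 * D x ^ 2)
        (fun k => ((Lp.aestronglyMeasurable _).norm.pow 2)) (hD.const_mul 4) (fun k => ?_) ?_
      · filter_upwards [hK (u (n k) - v)] with x hx
        have h1 : ‖u (n k) - v‖ ≤ 2 := by
          have := hu (n k)
          rw [mem_closedBall_zero_iff] at this
          linarith [norm_sub_le (u (n k)) v]
        have h2 : ‖inner ℂ (g x) (u (n k) - v)‖ ≤ D x * 2 :=
          (norm_inner_le_norm _ _).trans
            (mul_le_mul (hg x) h1 (norm_nonneg _) ((norm_nonneg _).trans (hg x)))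
        rw [hx, Real.norm_eq_abs, abs_of_nonneg (by positivity)]
        nlinarith [norm_nonneg (inner ℂ (g x) (u (n k) - v))]
      · filter_upwards [ae_all_iff.2 fun k => hK (u (n k) - v)] with x hx
        have h3 : Tendsto (fun k => inner ℂ (g x) (u (n k)) - inner ℂ (g x) v) atTop (𝓝 0) := by
          simpa using (hlim (g x)).sub_const (inner ℂ (g x) v)
        have h4 : Tendsto (fun k => ‖inner ℂ (g x) (u (n k)) - inner ℂ (g x) v‖ ^ 2) atTop (𝓝 0) := by
          simpa using h3.norm.pow 2
        refine h4.congr fun k => ?_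
        rw [hx, inner_sub_right]
    rw [tendsto_iff_norm_sub_tendsto_zero]
    have h5 := hsq.sqrt
    rw [integral_zero, Real.sqrt_zero] at h5
    refine h5.congr fun k => ?_
    rw [← Lp_two_norm_sq_eq_integral, Real.sqrt_sq (norm_nonneg _), map_sub, huy]
    rfl
  refine (isCompactOperator_iff_isCompact_closure_image_closedBall
    (K : Lp ℂ 2 μ →ₗ[ℂ] Lp ℂ 2 μ) one_pos).2 ?_
  exact hcomp.isClosed.closure_eq.symm ▸ hcomp

instance Lp_two_separableSpace (d : ℕ) :
    TopologicalSpace.SeparableSpace (Lp ℂ 2 (volume : Measure (Fin d → ℝ))) :=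
  have : Fact ((2 : ENNReal) ≠ ⊤) := ⟨ENNReal.ofNat_ne_top⟩
  inferInstance

open scoped Pointwise in
theorem isCompactOperator_conv_comp_mul_of_hasCompactSupport {d : ℕ} {b w : (Fin d → ℝ) → ℂ}
    (hb : Continuous b) (hbs : HasCompactSupport b) (hw : MemLp w 2) {s : Set (Fin d → ℝ)}
    (hs : IsCompact s) (hws : ∀ x ∉ s, w x = 0)
    (A M : Lp ℂ 2 (volume : Measure (Fin d → ℝ)) →L[ℂ] Lp ℂ 2 (volume : Measure (Fin d → ℝ)))
    (hA : ∀ u : Lp ℂ 2 (volume : Measure (Fin d → ℝ)),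
      A u =ᵐ[volume] fun x => ∫ y, b (x - y) * u y)
    (hM : ∀ u : Lp ℂ 2 (volume : Measure (Fin d → ℝ)), M u =ᵐ[volume] fun x => w x * u x) :
    IsCompactOperator (A ∘L M) := by
  obtain ⟨B, hB⟩ := hbs.exists_bound_of_continuous hb
  have hB0 : 0 ≤ B := (norm_nonneg _).trans (hB 0)
  have hmem : ∀ x, MemLp (fun y => starRingEnd ℂ (b (x - y) * w y)) 2 := fun x =>
    (MemLp.of_le_mul hw (c := B)
      ((hb.comp (continuous_const.sub continuous_id)).aestronglyMeasurable.mul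
        hw.aestronglyMeasurable)
      (.of_forall fun y => by simpa using
        mul_le_mul_of_nonneg_right (hB (x - y)) (norm_nonneg (w y)))).star
  let t : Set (Fin d → ℝ) := tsupport b + s
  have ht : IsCompact t := hbs.isCompact.add hs
  let W : ℝ := B * ‖hw.toLp w‖
  have hnorm : ∀ x, ‖(hmem x).toLp _‖ ≤ t.indicator (fun _ => W) x := fun x => by
    by_cases hx : x ∈ t
    · rw [Set.indicator_of_mem hx]
      refine Lp.norm_le_mul_norm_of_ae_le_mul ?_
      filter_upwards [(hmem x).coeFn_toLp, hw.coeFn_toLp] with y h1 h2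
      rw [h1, h2]
      simpa using mul_le_mul_of_nonneg_right (hB (x - y)) (norm_nonneg (w y))
    · rw [Set.indicator_of_notMem hx]
      have h0 : ∀ y, starRingEnd ℂ (b (x - y) * w y) = 0 := fun y => by
        by_cases hy : y ∈ s
        · have : x - y ∉ tsupport b := fun h => hx ⟨x - y, h, y, hy, sub_add_cancel x y⟩
          rw [image_eq_zero_of_notMem_tsupport this]
          simp
        · rw [hws y hy]
          simp
      refine le_of_eq (norm_eq_zero.2 ?_)
      ext1
      filter_upwards [(hmem x).coeFn_toLp, Lp.coeFn_zero ℂ 2 (volume : Measure (Fin d → ℝ))]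
        with y h1 h2
      rw [h1, h2, h0, Pi.zero_apply]
  refine isCompactOperator_of_kernel (A ∘L M) (fun x => (hmem x).toLp _) ?_ hnorm fun u => ?_
  · have : (fun x => t.indicator (fun _ => W) x ^ 2) = t.indicator (fun _ => W ^ 2) := by
      ext x
      by_cases hx : x ∈ t <;> simp [hx]
    rw [this, integrable_indicator_iff ht.isClosed.measurableSet]
    exact integrableOn_const ht.measure_lt_top.ne
  · refine (hA (M u)).trans (.of_forall fun x => ?_)
    simp only
    rw [L2.inner_def]
    refine integral_congr_ae ?_
    filter_upwards [hM u, (hmem x).coeFn_toLp] with y h1 h2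
    rw [h1, h2, RCLike.inner_apply, Complex.conj_conj]
    ring

open Filter Topology in
/-- The product of a convolution operator with integrable kernel and the multiplication operator
by a continuous function vanishing at infinity is compact. -/
theorem isCompactOperator_conv_comp_mul {d : ℕ} {a w : (Fin d → ℝ) → ℂ}
    (ha : Integrable a) (hw : Continuous w) (hw0 : Tendsto w (cocompact _) (𝓝 0))
    (A M : Lp ℂ 2 (volume : Measure (Fin d → ℝ)) →L[ℂ] Lp ℂ 2 (volume : Measure (Fin d → ℝ)))
    (hA : ∀ u : Lp ℂ 2 (volume : Measure (Fin d → ℝ)),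
      A u =ᵐ[volume] fun x => ∫ y, a (x - y) * u y)
    (hM : ∀ u : Lp ℂ 2 (volume : Measure (Fin d → ℝ)), M u =ᵐ[volume] fun x => w x * u x) :
    IsCompactOperator (A ∘L M) := by
  have happrox : ∀ ε > 0, ∃ (A' M' : Lp ℂ 2 (volume : Measure (Fin d → ℝ)) →L[ℂ]
      Lp ℂ 2 (volume : Measure (Fin d → ℝ))),
      ‖A - A'‖ ≤ ε ∧ ‖M - M'‖ ≤ ε ∧ IsCompactOperator (A' ∘L M') := fun ε hε => by
    obtain ⟨b, hbs, hab, hb, hbi⟩ := ha.exists_hasCompactSupport_integral_sub_le hε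
    obtain ⟨s, hs, hsw⟩ := mem_cocompact.1 (hw0 (Metric.closedBall_mem_nhds 0 hε))
    have hsm : MeasurableSet s := hs.isClosed.measurableSet
    obtain ⟨C, hC⟩ := hs.exists_bound_of_continuousOn hw.continuousOn
    obtain ⟨A', -, hA'⟩ := exists_conv_clm hbi
    obtain ⟨A₁, hA₁n, hA₁⟩ := exists_conv_clm (ha.sub hbi)
    have hind : AEStronglyMeasurable (s.indicator w) (volume : Measure (Fin d → ℝ)) :=
      hw.aestronglyMeasurable.indicator hsm
    have hbd : ∀ x, ‖s.indicator w x‖ ≤ max C 0 := fun x => by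
      by_cases hx : x ∈ s
      · simpa [hx] using Or.inl (hC x hx)
      · simp [hx]
    obtain ⟨M', -, hM'⟩ := exists_mul_clm hind (le_max_right C 0) hbd
    obtain ⟨M₁, hM₁n, hM₁⟩ := exists_mul_clm (hw.aestronglyMeasurable.sub hind) hε.le
      (fun x => by
        by_cases hx : x ∈ s
        · simpa [hx] using hε.le
        · simpa [hx] using hsw hx)
    refine ⟨A', M', ?_, ?_, ?_⟩
    · have : A - A' = A₁ := by
        ext u : 1
        ext1
        filter_upwards [hA u, hA' u, hA₁ u, Lp.coeFn_sub (A u) (A' u), ae_integrable_sub_mul ha u,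
          ae_integrable_sub_mul hbi u] with x h1 h2 h3 h4 h5 h6
        rw [sub_apply, h4, Pi.sub_apply, h1, h2, h3, ← integral_sub h5.2 h6.2]
        simp [sub_mul]
      rw [this]
      exact hA₁n.trans hab
    · have : M - M' = M₁ := by
        ext u : 1
        ext1
        filter_upwards [hM u, hM' u, hM₁ u, Lp.coeFn_sub (M u) (M' u)] with x h1 h2 h3 h4
        rw [sub_apply, h4, Pi.sub_apply, h1, h2, h3, Pi.sub_apply, sub_mul]
      rwa [this]
    · refine isCompactOperator_conv_comp_mul_of_hasCompactSupport hb hbs (w := s.indicator w) ?_ hs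
        (fun x hx => Set.indicator_of_notMem hx w) A' M' hA' hM'
      rw [memLp_indicator_iff_restrict hsm]
      have : IsFiniteMeasure ((volume : Measure (Fin d → ℝ)).restrict s) :=
        ⟨by simpa using hs.measure_lt_top⟩
      exact MemLp.of_bound hw.aestronglyMeasurable C (ae_restrict_of_forall_mem hsm hC)
  choose A' M' hA' hM' hc using fun n : ℕ => happrox (1 / (n + 1)) (by positivity)
  have hlim : ∀ {N : Lp ℂ 2 (volume : Measure (Fin d → ℝ)) →L[ℂ]
      Lp ℂ 2 (volume : Measure (Fin d → ℝ))} {N' : ℕ → Lp ℂ 2 (volume : Measure (Fin d → ℝ)) →L[ℂ]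
      Lp ℂ 2 (volume : Measure (Fin d → ℝ))}, (∀ n : ℕ, ‖N - N' n‖ ≤ 1 / ((n : ℝ) + 1)) →
      Tendsto N' atTop (𝓝 N) := fun h => by
    rw [tendsto_iff_norm_sub_tendsto_zero]
    exact squeeze_zero (fun n => norm_nonneg _) (fun n => (norm_sub_rev _ _).trans_le (h n))
      tendsto_one_div_add_atTop_nhds_zero_nat
  have hprod : Tendsto (fun n => (A' n) ∘L (M' n)) atTop (𝓝 (A ∘L M)) :=
    (hlim hA').mul (hlim hM')
  exact isCompactOperator_of_tendsto hprod (.of_forall hc)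

open FourierTransform in
/-- The quadratic form of a convolution operator on Schwartz functions, in Fourier variables. -/
theorem integral_conj_convolution_mul_self {V : Type*} [NormedAddCommGroup V]
    [InnerProductSpace ℝ V] [FiniteDimensional ℝ V] [MeasurableSpace V] [BorelSpace V]
    {a : V → ℂ} (ha : Integrable a) (f : SchwartzMap V ℂ) :
    ∫ x, starRingEnd ℂ (∫ y, a (x - y) * f y) * f x =
      ∫ ξ, starRingEnd ℂ (𝓕 a ξ) * ((‖𝓕 f ξ‖ ^ 2 : ℝ) : ℂ) := by
  set c : V → ℂ := convolution a f (.mul ℂ ℂ) volume with hc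
  have hconv : ∀ x, c x = ∫ y, a (x - y) * f y := fun x => by
    rw [hc, convolution, ← integral_sub_left_eq_self _ volume x]
    simp
  have hci : Integrable c := ha.integrable_convolution _ f.integrable
  have hinv : ∫ ξ, starRingEnd ℂ (𝓕 c ξ) * 𝓕 f ξ = ∫ x, starRingEnd ℂ (c x) * f x := by
    have h := VectorFourier.integral_sesq_fourierIntegral_eq_neg_flip (innerSL ℂ : ℂ →L⋆[ℂ] ℂ →L[ℂ] ℂ)
      (L := innerₗ V) Real.continuous_fourierChar continuous_inner hci (𝓕 f).integrable
      (μ := volume) (ν := volume)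
    have h2 : VectorFourier.fourierIntegral Real.fourierChar volume (-(innerₗ V).flip)
        (𝓕 f : SchwartzMap V ℂ) = f := by
      have h3 : (⇑(𝓕⁻ (𝓕 f) : SchwartzMap V ℂ) : V → ℂ) = f := by
        rw [FourierTransform.fourierInv_fourier_eq]
      rw [SchwartzMap.fourierInv_coe] at h3
      rw [flip_innerₗ]
      exact h3
    rw [h2] at h
    simp only [innerSL_apply_apply, RCLike.inner_apply] at h
    have h' : ∫ ξ, 𝓕 f ξ * starRingEnd ℂ (𝓕 c ξ) = ∫ x, f x * starRingEnd ℂ (c x) := h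
    simpa only [mul_comm] using h'
  simp_rw [← hconv]
  rw [← hinv]
  congr 1 with ξ
  have h4 : 𝓕 c ξ = 𝓕 a ξ * 𝓕 f ξ := Real.fourier_mul_convolution_eq ha f.integrable ξ
  rw [h4, map_mul, mul_assoc, Complex.conj_mul']
  push_cast
  rfl

open FourierTransform in
/-- A lower bound on a real-valued Fourier transform `𝓕 a` gives a lower bound on the quadratic form
of the convolution with `a`. -/
theorem convolution_form_schwartz_ge {V : Type*} [NormedAddCommGroup V]
    [InnerProductSpace ℝ V] [FiniteDimensional ℝ V] [MeasurableSpace V] [BorelSpace V]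
    {a : V → ℂ} (ha : Integrable a) {m : V → ℝ} (hm : ∀ ξ, 𝓕 a ξ = m ξ) {v : ℝ}
    (hv : ∀ ξ, v ≤ m ξ) (f : SchwartzMap V ℂ) :
    (∫ x, starRingEnd ℂ (∫ y, a (x - y) * f y) * f x).im = 0 ∧
      v * ∫ x, ‖f x‖ ^ 2 ≤ (∫ x, starRingEnd ℂ (∫ y, a (x - y) * f y) * f x).re := by
  have h : ∫ x, starRingEnd ℂ (∫ y, a (x - y) * f y) * f x =
      ((∫ ξ, m ξ * ‖𝓕 f ξ‖ ^ 2 : ℝ) : ℂ) := by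
    rw [integral_conj_convolution_mul_self ha, ← integral_complex_ofReal]
    congr 1 with ξ
    rw [hm, Complex.conj_ofReal]
    push_cast
    rfl
  have hcont : Continuous m := by
    have : Continuous (𝓕 a) := VectorFourier.fourierIntegral_continuous (L := innerₗ V)
      Real.continuous_fourierChar continuous_inner ha
    rw [funext hm] at this
    exact Complex.continuous_re.comp this
  have hi : Integrable (fun ξ => ‖𝓕 f ξ‖ ^ 2) :=
    (memLp_two_iff_integrable_sq_norm (𝓕 f).continuous.aestronglyMeasurable).1 ((𝓕 f).memLp 2)
  rw [h, Complex.ofReal_im, Complex.ofReal_re]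
  refine ⟨rfl, ?_⟩
  rw [← SchwartzMap.integral_norm_sq_fourier f, ← integral_const_mul]
  refine integral_mono (hi.const_mul v) ?_ fun ξ => by
    simp only
    gcongr
    exact hv ξ
  refine hi.bdd_mul (c := ∫ x, ‖a x‖) hcont.aestronglyMeasurable (.of_forall fun ξ => ?_)
  have := VectorFourier.norm_fourierIntegral_le_integral_norm Real.fourierChar volume (innerₗ V) a ξ
  rw [← Complex.norm_real, ← hm]
  exact this

open FourierTransform in
/-- A lower bound on a real-valued Fourier transform of `a` gives a lower bound on the quadratic form
of the convolution operator on `L²`. -/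
theorem conv_form_ge {d : ℕ} {a : (Fin d → ℝ) → ℂ} (ha : Integrable a) {m : (Fin d → ℝ) → ℝ}
    (hm : ∀ ξ, (m ξ : ℂ) = ∫ x, Complex.exp (-Complex.I * (∑ i, ξ i * x i)) * a x)
    {v : ℝ} (hv : ∀ ξ, v ≤ m ξ)
    (A : Lp ℂ 2 (volume : Measure (Fin d → ℝ)) →L[ℂ] Lp ℂ 2 (volume : Measure (Fin d → ℝ)))
    (hA : ∀ u : Lp ℂ 2 (volume : Measure (Fin d → ℝ)),
      A u =ᵐ[volume] fun x => ∫ y, a (x - y) * u y)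
    (u : Lp ℂ 2 (volume : Measure (Fin d → ℝ))) :
    (inner ℂ (A u) u).im = 0 ∧ v * ‖u‖ ^ 2 ≤ (inner ℂ (A u) u).re := by
  have hdense := SchwartzMap.denseRange_toLpCLM (F := ℂ) (p := 2)
    (μ := (volume : Measure (Fin d → ℝ))) ENNReal.ofNat_ne_top
  refine hdense.induction_on (p := fun u => (inner ℂ (A u) u).im = 0 ∧
    v * ‖u‖ ^ 2 ≤ (inner ℂ (A u) u).re) u ?_ fun f => ?_
  · have hc : Continuous fun u => inner ℂ (A u) u := A.continuous.inner continuous_id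
    exact (isClosed_eq (Complex.continuous_im.comp hc) continuous_const).inter
      (isClosed_le (by fun_prop) (Complex.continuous_re.comp hc))
  · set e := EuclideanSpace.equiv (Fin d) ℝ
    have hmp : MeasurePreserving (WithLp.ofLp : EuclideanSpace ℝ (Fin d) → (Fin d → ℝ)) :=
      PiLp.volume_preserving_ofLp (Fin d)
    have hemb : MeasurableEmbedding (WithLp.ofLp : EuclideanSpace ℝ (Fin d) → (Fin d → ℝ)) :=
      (MeasurableEquiv.toLp 2 (Fin d → ℝ)).symm.measurableEmbedding
    let g : SchwartzMap (EuclideanSpace ℝ (Fin d)) ℂ :=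
      SchwartzMap.compCLMOfContinuousLinearEquiv ℂ e f
    have hg : ∀ x, g x = f (WithLp.ofLp x) := fun x => rfl
    have hfour : ∀ ξ : EuclideanSpace ℝ (Fin d),
        𝓕 (fun x : EuclideanSpace ℝ (Fin d) => a (WithLp.ofLp x)) ξ
          = (m ((2 * Real.pi) • WithLp.ofLp ξ) : ℂ) := fun ξ => by
      rw [hm, Real.fourier_eq', ← hmp.integral_comp hemb]
      congr 1 with x
      rw [smul_eq_mul, PiLp.inner_apply]
      congr 2
      push_cast
      rw [mul_comm, neg_mul, neg_mul, neg_mul, mul_neg]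
      congr 2
      rw [Finset.mul_sum]
      refine Finset.sum_congr rfl fun i _ => ?_
      simp
      ring
    obtain ⟨him, hre⟩ := convolution_form_schwartz_ge
      (a := fun x : EuclideanSpace ℝ (Fin d) => a (WithLp.ofLp x))
      (hmp.integrable_comp_of_integrable ha) hfour (fun ξ => hv _) g
    have hin : ∀ x : EuclideanSpace ℝ (Fin d), ∫ y : EuclideanSpace ℝ (Fin d),
        a (WithLp.ofLp (x - y)) * g y = ∫ y, a (WithLp.ofLp x - y) * f y := fun x => by
      rw [← hmp.integral_comp hemb]
      rfl
    have hform : ∫ x, starRingEnd ℂ (∫ y : EuclideanSpace ℝ (Fin d),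
        a (WithLp.ofLp (x - y)) * g y) * g x = inner ℂ (A (f.toLp 2)) (f.toLp 2) := by
      rw [L2.inner_def]
      simp_rw [hin, hg]
      rw [hmp.integral_comp hemb
        (fun x => starRingEnd ℂ (∫ y, a (x - y) * f y) * f x)]
      refine integral_congr_ae ?_
      filter_upwards [hA (f.toLp 2), f.coeFn_toLp 2] with x h1 h2
      rw [h1, h2, RCLike.inner_apply, mul_comm]
      congr 2
      refine integral_congr_ae ?_
      filter_upwards [f.coeFn_toLp 2] with y h3
      rw [h3]
    have hnorm : ∫ x, ‖g x‖ ^ 2 = ‖f.toLp 2‖ ^ 2 := by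
      rw [Lp_two_norm_sq_eq_integral]
      simp_rw [hg]
      rw [hmp.integral_comp hemb (fun x => ‖f x‖ ^ 2)]
      refine integral_congr_ae ?_
      filter_upwards [f.coeFn_toLp 2] with x h1
      rw [h1]
    rw [hform] at him hre
    rw [hnorm] at hre
    exact ⟨him, hre⟩

theorem cube_eq_pi (d : ℕ) (r : ℝ) (x0 : Fin d → ℝ) :
    cube d r x0 = Set.univ.pi fun i => Set.Ioo (x0 i - r / 2) (x0 i + r / 2) := by
  ext x
  simp only [cube, Set.mem_ofPred_eq, Set.mem_pi, Set.mem_univ, true_implies, Set.mem_Ioo]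
  refine forall_congr' fun i => ?_
  rw [abs_lt]
  constructor <;> rintro ⟨h1, h2⟩ <;> constructor <;> linarith

theorem measurableSet_cube (d : ℕ) (r : ℝ) (x0 : Fin d → ℝ) : MeasurableSet (cube d r x0) := by
  rw [cube_eq_pi]
  exact .univ_pi fun i => measurableSet_Ioo

theorem volume_real_cube {d : ℕ} {r : ℝ} (hr : 0 ≤ r) (x0 : Fin d → ℝ) :
    volume.real (cube d r x0) = r ^ d := by
  rw [cube_eq_pi, measureReal_def, Real.volume_pi_Ioo, ENNReal.toReal_prod]
  simp [hr]

theorem volume_cube_ne_top (d : ℕ) (r : ℝ) (x0 : Fin d → ℝ) : volume (cube d r x0) ≠ ⊤ := by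
  rw [cube_eq_pi, Real.volume_pi_Ioo]
  exact ENNReal.prod_ne_top fun i _ => ENNReal.ofReal_ne_top

/-- The volume of the intersection of a cube with its translate by `z`. -/
theorem volume_real_cube_inter_preimage_sub {d : ℕ} (r : ℝ) (x0 z : Fin d → ℝ) :
    volume.real (cube d r x0 ∩ (fun x => x - z) ⁻¹' cube d r x0) = ∏ i, max (r - |z i|) 0 := by
  have : cube d r x0 ∩ (fun x => x - z) ⁻¹' cube d r x0 = Set.univ.pi fun i =>
      Set.Ioo (max (x0 i - r / 2) (x0 i - r / 2 + z i))
        (min (x0 i + r / 2) (x0 i + r / 2 + z i)) := by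
    ext x
    simp only [cube_eq_pi, Set.mem_inter_iff, Set.mem_preimage, Set.mem_pi, Set.mem_univ,
      true_implies, Set.mem_Ioo, ← forall_and, Pi.sub_apply, max_lt_iff, lt_min_iff]
    refine forall_congr' fun i => ?_
    constructor
    · rintro ⟨⟨h1, h2⟩, h3, h4⟩
      refine ⟨⟨h1, ?_⟩, h2, ?_⟩ <;> linarith
    · rintro ⟨⟨h1, h2⟩, h3, h4⟩
      refine ⟨⟨h1, h3⟩, ?_, ?_⟩ <;> linarith
  rw [this, measureReal_def, Real.volume_pi_Ioo, ENNReal.toReal_prod]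
  refine Finset.prod_congr rfl fun i _ => ?_
  rw [ENNReal.toReal_ofReal']
  congr 1
  rcases le_total 0 (z i) with h | h
  · rw [min_eq_left (by linarith), max_eq_right (by linarith), abs_of_nonneg h]
    ring
  · rw [min_eq_right (by linarith), max_eq_left (by linarith), abs_of_nonpos h]
    ring

/-- The double integral of `a (x - y)` over `s × s` as a weighted integral of `a`. -/
theorem setIntegral_setIntegral_sub {G : Type*} [NormedAddCommGroup G] [MeasurableSpace G]
    [BorelSpace G] [SecondCountableTopology G] {μ : Measure G} [SigmaFinite μ]
    [μ.IsAddLeftInvariant] [μ.IsNegInvariant]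
    {a : G → ℂ} (ha : Integrable a μ) {s : Set G} (hs : MeasurableSet s) (hμs : μ s ≠ ⊤) :
    ∫ x in s, ∫ y in s, a (x - y) ∂μ ∂μ =
      ∫ z, (μ.real (s ∩ (fun x => x - z) ⁻¹' s) : ℂ) * a z ∂μ := by
  have : IsFiniteMeasure (μ.restrict s) := ⟨by simpa using hμs.lt_top⟩
  have h1 : ∀ x, ∫ y in s, a (x - y) ∂μ = ∫ z, s.indicator 1 (x - z) * a z ∂μ := fun x => by
    rw [← integral_indicator hs, ← integral_sub_left_eq_self _ μ x]
    congr 1 with z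
    by_cases h : x - z ∈ s <;> simp [h]
  have h2 : Integrable (fun p : G × G => s.indicator (1 : G → ℂ) (p.1 - p.2) * a p.2)
      ((μ.restrict s).prod μ) := by
    refine (ha.comp_snd _).bdd_mul (c := 1) ?_ (.of_forall fun p => ?_)
    · exact ((measurable_one.indicator hs).comp
        (measurable_fst.sub measurable_snd)).aestronglyMeasurable
    · by_cases h : p.1 - p.2 ∈ s <;> simp [h]
  simp_rw [h1]
  rw [integral_integral_swap h2]
  congr 1 with z
  rw [integral_mul_const]
  congr 1
  have hm : MeasurableSet ((fun x => x - z) ⁻¹' s) := hs.preimage (measurable_sub_const z)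
  have h3 : (fun x => s.indicator (1 : G → ℂ) (x - z)) =
      ((fun x => x - z) ⁻¹' s).indicator 1 := rfl
  rw [h3, Pi.one_def, integral_indicator_const _ hm, measureReal_restrict_apply hm, Set.inter_comm]
  simp

/-- The scaled form of the convolution part of the energy of the indicator of a cube. -/
theorem re_setIntegral_setIntegral_cube_sub {d : ℕ} {a : (Fin d → ℝ) → ℂ} (ha : Integrable a)
    (x0 : Fin d → ℝ) {δ : ℝ} (hδ : 0 < δ) :
    (∫ x in cube d δ x0, ∫ y in cube d δ x0, a (x - y)).re =
      δ ^ d * (δ ^ d * ∫ x in cube d 2 0, (∏ i, (1 - |x i|)) * (a (δ • x)).re) := by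
  set F : (Fin d → ℝ) → ℝ := fun z => (∏ i, max (δ - |z i|) 0) * (a z).re with hF
  have h1 : (∫ x in cube d δ x0, ∫ y in cube d δ x0, a (x - y)).re = ∫ z, F z := by
    have hle : ∀ z : Fin d → ℝ, ∏ i, max (δ - |z i|) 0 ≤ δ ^ d := fun z =>
      (Finset.prod_le_prod (fun i _ => le_max_right _ _) fun i _ =>
        max_le (by linarith [abs_nonneg (z i)]) hδ.le).trans (by simp)
    have hi : Integrable fun z : Fin d → ℝ => ((∏ i, max (δ - |z i|) 0 : ℝ) : ℂ) * a z := by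
      refine ha.bdd_mul (c := δ ^ d) ?_ (.of_forall fun z => ?_)
      · exact Continuous.aestronglyMeasurable (by fun_prop)
      · rw [Complex.norm_real, Real.norm_of_nonneg
          (Finset.prod_nonneg fun i _ => le_max_right _ _)]
        exact hle z
    rw [setIntegral_setIntegral_sub ha (measurableSet_cube d δ x0) (volume_cube_ne_top d δ x0)]
    simp_rw [volume_real_cube_inter_preimage_sub]
    refine (integral_re hi).symm.trans (integral_congr_ae (.of_forall fun z => ?_))
    exact Complex.re_ofReal_mul _ _
  have h2 : ∀ x, F (δ • x) =
      δ ^ d * (cube d 2 0).indicator (fun x => (∏ i, (1 - |x i|)) * (a (δ • x)).re) x := fun x => by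
    have h3 : ∏ i, max (δ - |(δ • x) i|) 0 = δ ^ d * ∏ i, max (1 - |x i|) 0 := by
      rw [← Fin.prod_const, ← Finset.prod_mul_distrib]
      refine Finset.prod_congr rfl fun i _ => ?_
      rw [mul_max_of_nonneg _ _ hδ.le, Pi.smul_apply, smul_eq_mul, abs_mul, abs_of_pos hδ]
      ring_nf
    simp only [hF]
    rw [h3, mul_assoc]
    congr 1
    by_cases hx : x ∈ cube d 2 0
    · rw [Set.indicator_of_mem hx]
      congr 1
      refine Finset.prod_congr rfl fun i _ => max_eq_left ?_
      have := hx i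
      simp only [Pi.zero_apply, sub_zero] at this
      linarith
    · rw [Set.indicator_of_notMem hx]
      simp only [cube, Set.mem_ofPred_eq, not_forall, not_lt, Pi.zero_apply, sub_zero] at hx
      obtain ⟨i, hi⟩ := hx
      rw [Finset.prod_eq_zero (Finset.mem_univ i) (max_eq_right (by linarith)), zero_mul]
  have h4 := Measure.integral_comp_smul volume F δ
  simp_rw [h2] at h4
  rw [integral_const_mul, integral_indicator (measurableSet_cube d 2 0), Module.finrank_fin_fun,
    abs_of_pos (by positivity), smul_eq_mul] at h4
  rw [h1, h4]
  field_simp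

/-- The integral over a cube, rescaled to the unit cube. -/
theorem setIntegral_cube_eq {d : ℕ} (W : (Fin d → ℝ) → ℝ) (x0 : Fin d → ℝ) {δ : ℝ} (hδ : 0 < δ) :
    ∫ x in cube d δ x0, W x = δ ^ d * ∫ x in cube d 1 0, W (x0 + δ • x) := by
  have h2 : ∀ x, (cube d δ x0).indicator W (x0 + δ • x) =
      (cube d 1 0).indicator (fun x => W (x0 + δ • x)) x := fun x => by
    have : x0 + δ • x ∈ cube d δ x0 ↔ x ∈ cube d 1 0 := by
      refine forall_congr' fun i => ?_
      simp only [Pi.add_apply, Pi.smul_apply, smul_eq_mul, add_sub_cancel_left, Pi.zero_apply,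
        sub_zero, abs_mul, abs_of_pos hδ]
      rw [← mul_one_div δ, mul_lt_mul_iff_right₀ hδ]
    by_cases hx : x ∈ cube d 1 0
    · rw [Set.indicator_of_mem hx, Set.indicator_of_mem (this.2 hx)]
    · rw [Set.indicator_of_notMem hx, Set.indicator_of_notMem (this.not.2 hx)]
  have h4 := Measure.integral_comp_smul volume (fun x => (cube d δ x0).indicator W (x0 + x)) δ
  simp_rw [h2] at h4
  rw [integral_add_left_eq_self ((cube d δ x0).indicator W),
    integral_indicator (measurableSet_cube d δ x0),
    integral_indicator (measurableSet_cube d 1 0), Module.finrank_fin_fun,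
    abs_of_pos (by positivity), smul_eq_mul] at h4
  rw [h4]
  field_simp

/-- The energy of the indicator of a cube. -/
theorem form_indicatorConstLp_cube_lt {d : ℕ} {a : (Fin d → ℝ) → ℂ} (ha : Integrable a)
    {V : (Fin d → ℝ) → ℝ} (hV : Continuous V) {x0 : Fin d → ℝ} {v δ : ℝ} (hδ : 0 < δ)
    (hcond : (∫ x in cube d 2 0, (∏ i, (1 - |x i|)) * (a (δ • x)).re) +
        δ ^ (-(d : ℝ)) * ∫ x in cube d 1 0, (V (x0 + δ • x) - v) < 0)
    (A M : Lp ℂ 2 (volume : Measure (Fin d → ℝ)) →L[ℂ] Lp ℂ 2 (volume : Measure (Fin d → ℝ)))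
    (hA : ∀ u : Lp ℂ 2 (volume : Measure (Fin d → ℝ)),
      A u =ᵐ[volume] fun x => ∫ y, a (x - y) * u y)
    (hM : ∀ u : Lp ℂ 2 (volume : Measure (Fin d → ℝ)), M u =ᵐ[volume] fun x => (V x : ℂ) * u x)
    (f : Lp ℂ 2 (volume : Measure (Fin d → ℝ)))
    (hf : f = indicatorConstLp 2 (measurableSet_cube d δ x0) (volume_cube_ne_top d δ x0) 1) :
    (inner ℂ (A f + M f) f).re < v * ‖f‖ ^ 2 := by
  set s := cube d δ x0 with hs
  have hsm : MeasurableSet s := measurableSet_cube d δ x0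
  have hsf : volume s ≠ ⊤ := volume_cube_ne_top d δ x0
  have hfe : f =ᵐ[volume] s.indicator fun _ => 1 := by
    rw [hf]
    exact indicatorConstLp_coeFn
  have hre : ∀ g, (inner ℂ g f).re = (∫ x in s, g x).re := fun g => by
    rw [← inner_conj_symm, Complex.conj_re, hf, L2.inner_indicatorConstLp_one]
  have hnorm : ‖f‖ ^ 2 = δ ^ d := by
    rw [Lp_two_norm_sq_eq_integral, ← volume_real_cube hδ.le x0, ← hs,
      ← integral_indicator_one hsm]
    refine integral_congr_ae ?_
    filter_upwards [hfe] with x hx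
    rw [hx]
    by_cases h : x ∈ s <;> simp [h]
  have hAf : (inner ℂ (A f) f).re = (∫ x in s, ∫ y in s, a (x - y)).re := by
    rw [hre]
    congr 1
    refine integral_congr_ae (ae_restrict_of_ae ?_)
    filter_upwards [hA f] with x hx
    rw [hx, ← integral_indicator hsm]
    refine integral_congr_ae ?_
    filter_upwards [hfe] with y hy
    rw [hy]
    by_cases h : y ∈ s <;> simp [h]
  have hMf : (inner ℂ (M f) f).re = ∫ x in s, V x := by
    rw [hre, ← Complex.ofReal_re (∫ x in s, V x), ← integral_complex_ofReal]
    congr 1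
    refine setIntegral_congr_ae hsm ?_
    filter_upwards [hM f, hfe] with x hx hy h
    rw [hx, hy]
    simp [h]
  have hVi : IntegrableOn V s := by
    have hsub : s ⊆ Set.Icc (fun i => x0 i - δ / 2) fun i => x0 i + δ / 2 := by
      rw [hs, cube_eq_pi, ← Set.pi_univ_Icc]
      exact Set.pi_mono fun i _ => Set.Ioo_subset_Icc_self
    exact (hV.continuousOn.integrableOn_compact isCompact_Icc).mono_set hsub
  have hsplit : ∫ x in s, V x = (∫ x in s, (V x - v)) + v * δ ^ d := by
    rw [integral_sub hVi (integrableOn_const hsf), setIntegral_const, hs,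
      volume_real_cube hδ.le, smul_eq_mul]
    ring
  rw [inner_add_left, Complex.add_re, hAf, hMf, hsplit, hnorm, hs,
    re_setIntegral_setIntegral_cube_sub ha x0 hδ, setIntegral_cube_eq (fun x => V x - v) x0 hδ]
  rw [Real.rpow_neg hδ.le, Real.rpow_natCast] at hcond
  have hδd : 0 < δ ^ d := by positivity
  have h := mul_neg_of_pos_of_neg (mul_pos hδd hδd) hcond
  rw [mul_add, ← mul_assoc (δ ^ d * δ ^ d) (δ ^ d)⁻¹, mul_assoc (δ ^ d) (δ ^ d) (δ ^ d)⁻¹,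
    mul_inv_cancel₀ hδd.ne', mul_one] at h
  linarith

/-- The quadratic form of multiplication by a real function bounded below. -/
theorem mul_form_ge {X : Type*} [MeasurableSpace X] {μ : Measure X} {V : X → ℝ} {v : ℝ}
    (hv : ∀ x, v ≤ V x) (M : Lp ℂ 2 μ →L[ℂ] Lp ℂ 2 μ)
    (hM : ∀ u : Lp ℂ 2 μ, M u =ᵐ[μ] fun x => (V x : ℂ) * u x) (u : Lp ℂ 2 μ) :
    (inner ℂ (M u) u).im = 0 ∧ v * ‖u‖ ^ 2 ≤ (inner ℂ (M u) u).re := by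
  have hpt : ∀ᵐ x ∂μ, inner ℂ (M u x) (u x) = ((V x * ‖u x‖ ^ 2 : ℝ) : ℂ) := by
    filter_upwards [hM u] with x hx
    rw [hx, RCLike.inner_apply, map_mul, Complex.conj_ofReal, mul_comm, mul_assoc,
      Complex.conj_mul']
    push_cast
    rfl
  have h : inner ℂ (M u) u = ((∫ x, V x * ‖u x‖ ^ 2 ∂μ : ℝ) : ℂ) := by
    rw [L2.inner_def, ← integral_complex_ofReal]
    exact integral_congr_ae hpt
  have hi : Integrable (fun x => V x * ‖u x‖ ^ 2) μ := by
    refine (L2.integrable_inner (𝕜 := ℂ) (M u) u).re.congr ?_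
    filter_upwards [hpt] with x hx
    rw [hx]
    exact Complex.ofReal_re _
  rw [h, Complex.ofReal_im, Complex.ofReal_re]
  refine ⟨rfl, ?_⟩
  rw [Lp_two_norm_sq_eq_integral, ← integral_const_mul]
  refine integral_mono ((Lp_two_integrable_norm_sq u).const_mul v) hi fun x => ?_
  simp only
  gcongr
  exact hv x

theorem inner_map_eq_of_im_eq_zero {H : Type*} [NormedAddCommGroup H] [InnerProductSpace ℂ H]
    (A : H →L[ℂ] H) (hA : ∀ u, (inner ℂ (A u) u).im = 0) (u w : H) :
    inner ℂ (A u) w = inner ℂ u (A w) :=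
  (LinearMap.isSymmetric_iff_inner_map_self_real (A : H →ₗ[ℂ] H)).2
    (fun u => Complex.conj_eq_iff_im.2 (hA u)) u w

/-- If `V` attains its global minimum at `x0`, `V_min ≤ a_min`, and the test-function
condition (2.8) holds for some `δ > 0`, then `ℒ = ℒ_{a⋆} + ℒ_V` has an eigenvalue
strictly below `V_min`. -/
theorem stmt_8 {d : ℕ} (hd : 0 < d) (a : (Fin d → ℝ) → ℂ) (V : (Fin d → ℝ) → ℝ)
    (hatA : (Fin d → ℝ) → ℝ) (x0 : Fin d → ℝ) (δ : ℝ) (hδ : 0 < δ)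
    (ha : Integrable a)
    (hsym : ∀ᵐ x ∂(volume : Measure (Fin d → ℝ)), a (-x) = starRingEnd ℂ (a x))
    (hVcont : Continuous V)
    (hV0 : Filter.Tendsto V (Filter.cocompact _) (nhds 0))
    (hmin : ∀ x, V x0 ≤ V x)
    (hA : ∀ ξ, (hatA ξ : ℂ) = ∫ x, Complex.exp (-Complex.I * (∑ i, ξ i * x i)) * a x)
    (hVa : ∀ ξ, V x0 ≤ hatA ξ)
    (hcond : (∫ x in cube d 2 0, (∏ i, (1 - |x i|)) * (a (δ • x)).re) +
        δ ^ (-(d : ℝ)) * ∫ x in cube d 1 0, (V (x0 + δ • x) - V x0) < 0)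
    (T : Lp ℂ 2 (volume : Measure (Fin d → ℝ)) →L[ℂ] Lp ℂ 2 (volume : Measure (Fin d → ℝ)))
    (hT : ∀ u : Lp ℂ 2 (volume : Measure (Fin d → ℝ)),
      (T u : (Fin d → ℝ) → ℂ) =ᵐ[volume] fun x => (∫ y, a (x - y) * u y) + (V x : ℂ) * u x) :
    ∃ E : ℝ, E < V x0 ∧
      ∃ φ : Lp ℂ 2 (volume : Measure (Fin d → ℝ)), φ ≠ 0 ∧ T φ = (E : ℂ) • φ := by
  have : Nonempty (Fin d) := ⟨⟨0, hd⟩⟩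
  have hv : V x0 ≤ 0 := ge_of_tendsto hV0 (.of_forall hmin)
  have hVc : Continuous fun x => (V x : ℂ) := Complex.continuous_ofReal.comp hVcont
  have hVc0 : Filter.Tendsto (fun x => (V x : ℂ)) (Filter.cocompact _) (nhds 0) := by
    simpa [Function.comp_def] using (Complex.continuous_ofReal.tendsto 0).comp hV0
  obtain ⟨C, hC⟩ := (ZeroAtInftyContinuousMap.isBounded_range
    (⟨⟨fun x => (V x : ℂ), hVc⟩, hVc0⟩ : ZeroAtInftyContinuousMap (Fin d → ℝ) ℂ)).exists_norm_le
  have hC' : ∀ x, ‖(V x : ℂ)‖ ≤ C := fun x => hC _ ⟨x, rfl⟩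
  obtain ⟨M, -, hM⟩ := exists_mul_clm (μ := (volume : Measure (Fin d → ℝ)))
    hVc.aestronglyMeasurable ((norm_nonneg _).trans (hC' x0)) hC'
  obtain ⟨A, -, hAconv⟩ := exists_conv_clm ha
  have hAform := conv_form_ge ha hA hVa A hAconv
  have hMform := mul_form_ge hmin M hM
  obtain ⟨E, hE, φ, hφ, hAM⟩ := exists_eigenvalue_lt_of_isCompactOperator_comp A M hv
    (inner_map_eq_of_im_eq_zero A fun u => (hAform u).1)
    (inner_map_eq_of_im_eq_zero M fun u => (hMform u).1)
    (fun u => (hAform u).2) (fun u => (hMform u).2)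
    (isCompactOperator_conv_comp_mul ha hVc hVc0 A M hAconv hM)
    (form_indicatorConstLp_cube_lt ha hVcont hδ hcond A M hAconv hM _ rfl)
  refine ⟨E, hE, φ, hφ, ?_⟩
  rw [← hAM]
  refine Lp.ext ?_
  filter_upwards [hT φ, hAconv φ, hM φ, Lp.coeFn_add (A φ) (M φ)] with x h1 h2 h3 h4
  rw [h1, h4, Pi.add_apply, h2, h3]
end

section
/- Suppose $a \in L_1(\mathbb{R}^d)$ is continuous at $0$ with $\mathrm{Re}\,a(0) < 0$, $V$ is real continuous vanishing at infinity with global minimum at $x_0$, $V_{\min} = V(x_0) \le \inf \mathcal{F}[a]$, and $V(x) - V_{\min} = O(|x-x_0|^\alpha)$ as $x \to x_0$ for some $\alpha > d$. Then $\mathcal{L} = \mathcal{L}_{a\star} + \mathcal{L}_V$ has at least one eigenvalue strictly below $V_{\min}$. -/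
open MeasureTheory

theorem re_inner_sub_smul_one_apply {H : Type*} [NormedAddCommGroup H]
    [InnerProductSpace ℂ H] (S : H →L[ℂ] H) (c : ℝ) (x : H) :
    RCLike.re (inner ℂ ((S - (c : ℂ) • 1) x) x) =
      RCLike.re (inner ℂ (S x) x) - c * ‖x‖ ^ 2 := by
  have h : (S - (c : ℂ) • 1) x = S x - (c : ℂ) • x := rfl
  rw [h, inner_sub_left, inner_smul_left, map_sub, Complex.conj_ofReal]
  congr 1
  rw [← inner_self_eq_norm_sq (𝕜 := ℂ) x]
  exact Complex.re_ofReal_mul _ _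

/-- If `A` and `M` are bounded below by `m ≤ 0` and `A M` is compact, then every spectral value of
`A + M` below `m` is an eigenvalue. -/
theorem exists_eigenvector_of_isCompactOperator_comp {H : Type*} [NormedAddCommGroup H]
    [InnerProductSpace ℂ H] [CompleteSpace H] (A M : H →L[ℂ] H) {m : ℝ} (hm : m ≤ 0)
    (hA : (A - (m : ℂ) • 1).IsPositive) (hM : (M - (m : ℂ) • 1).IsPositive)
    (hAM : IsCompactOperator (A * M)) {r : ℝ} (hr : r < m)
    (hspec : ¬ IsUnit (A + M - (r : ℂ) • 1)) :
    ∃ φ : H, φ ≠ 0 ∧ (A + M) φ = (r : ℂ) • φ := by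
  have key : ∀ S : H →L[ℂ] H, (S - (m : ℂ) • 1).IsPositive → IsUnit (S - (r : ℂ) • 1) := by
    intro S hS
    refine ContinuousLinearMap.isUnit_of_forall_le_norm_inner_map _ (c := ⟨m - r, by linarith⟩)
      (by exact_mod_cast sub_pos.2 hr) fun x => ?_
    have h1 := hS.re_inner_nonneg_left x
    rw [re_inner_sub_smul_one_apply] at h1
    have h3 := RCLike.re_le_norm (inner ℂ ((S - (r : ℂ) • 1) x) x)
    rw [re_inner_sub_smul_one_apply] at h3
    change ‖x‖ ^ 2 * (m - r) ≤ _
    linarith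
  obtain ⟨P, hP⟩ := (key A hA).mul (key M hM)
  have hr0 : (r : ℂ) ≠ 0 := by exact_mod_cast (hr.trans_le hm).ne
  set K : H →L[ℂ] H := (↑P⁻¹ : H →L[ℂ] H) * (A * M) with hK
  have hKc : IsCompactOperator K := hAM.clm_comp (↑P⁻¹ : H →L[ℂ] H)
  have hPK : (r : ℂ) • (A + M - (r : ℂ) • 1) = (P : H →L[ℂ] H) * (K - 1) := by
    rw [hK, mul_sub, ← mul_assoc, Units.mul_inv, hP]
    simp only [mul_sub, sub_mul, smul_sub, smul_add, one_mul, mul_one, mul_smul_comm,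
      smul_mul_assoc]
    abel
  rcases hKc.hasEigenvalue_or_mem_resolventSet one_ne_zero with h | h
  · obtain ⟨φ, hφ⟩ := h.exists_hasEigenvector
    refine ⟨φ, hφ.2, ?_⟩
    have h1 : K φ = φ := by simpa using hφ.apply_eq_smul
    have h2 := DFunLike.congr_fun hPK φ
    have h3 : (r : ℂ) • ((A + M) φ - (r : ℂ) • φ) = 0 := by
      refine h2.trans ?_
      simp [h1]
    exact sub_eq_zero.1 ((smul_eq_zero.1 h3).resolve_left hr0)
  · exfalso
    apply hspec
    rw [spectrum.mem_resolventSet_iff, map_one, ← IsUnit.neg_iff, neg_sub] at h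
    have := P.isUnit.mul h
    rw [← hPK] at this
    simpa using (isUnit_smul_iff (Units.mk0 _ hr0) _).1 this

/-- A self-adjoint operator whose quadratic form takes a value below `m` has a spectral value
below `m`. -/
theorem exists_not_isUnit_sub_of_inner_lt {H : Type*} [NormedAddCommGroup H]
    [InnerProductSpace ℂ H] [CompleteSpace H] (T : H →L[ℂ] H) (hT : IsSelfAdjoint T) {m : ℝ}
    (φ : H) (hφ : RCLike.re (inner ℂ (T φ) φ) < m * ‖φ‖ ^ 2) :
    ∃ r < m, ¬ IsUnit (T - (r : ℂ) • 1) := by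
  by_contra! hcon
  have hself : IsSelfAdjoint (T - (m : ℂ) • 1) := by
    apply hT.sub
    rw [isSelfAdjoint_iff, star_smul, star_one]
    simp
  have hpos : 0 ≤ T - (m : ℂ) • 1 := by
    rw [StarOrderedRing.nonneg_iff_spectrum_nonneg (R := ℝ) _ hself]
    intro s hs
    by_contra! hs0
    have := hcon (s + m) (by linarith)
    rw [spectrum.mem_iff] at hs
    apply hs
    rw [← IsUnit.neg_iff]
    convert this using 1
    rw [Algebra.algebraMap_eq_smul_one]
    ext x
    simp [add_smul]
    abel
  rw [ContinuousLinearMap.nonneg_iff_isPositive] at hpos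
  have := hpos.re_inner_nonneg_left φ
  rw [re_inner_sub_smul_one_apply] at this
  linarith

section Fourier

open VectorFourier SchwartzMap FourierTransform

/-- The pairing `(ξ, x) ↦ -∑ i, ξ i * x i`. -/
noncomputable def negDot (d : ℕ) : EuclideanSpace ℝ (Fin d) →ₗ[ℝ] (Fin d → ℝ) →ₗ[ℝ] ℝ :=
  LinearMap.mk₂ ℝ (fun ξ x => -∑ i, ξ i * x i)
    (fun a b x => by simp [add_mul, Finset.sum_add_distrib]; ring)
    (fun c a x => by simp [Finset.mul_sum, mul_assoc])
    (fun a b x => by simp [mul_add, Finset.sum_add_distrib]; ring)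
    (fun c a x => by simp [Finset.mul_sum, mul_left_comm])

theorem negDot_apply {d : ℕ} (ξ : EuclideanSpace ℝ (Fin d)) (x : Fin d → ℝ) :
    negDot d ξ x = -∑ i, ξ i * x i := rfl

theorem continuous_negDot (d : ℕ) :
    Continuous fun p : EuclideanSpace ℝ (Fin d) × (Fin d → ℝ) => negDot d p.1 p.2 := by
  simp only [negDot_apply]
  fun_prop

theorem continuous_neg_flip_negDot (d : ℕ) :
    Continuous fun p : (Fin d → ℝ) × EuclideanSpace ℝ (Fin d) => (-(negDot d).flip) p.1 p.2 := by
  simp only [LinearMap.neg_apply, LinearMap.flip_apply, negDot_apply]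
  fun_prop

/-- The Fourier transform of a Schwartz function on `Fin d → ℝ`. -/
noncomputable def piFourier {d : ℕ} (u : 𝓢(Fin d → ℝ, ℂ)) : 𝓢(EuclideanSpace ℝ (Fin d), ℂ) :=
  𝓕 (compCLMOfContinuousLinearEquiv ℂ (EuclideanSpace.equiv (Fin d) ℝ) u)

theorem fourierIntegral_piFourier {d : ℕ} (u : 𝓢(Fin d → ℝ, ℂ)) :
    fourierIntegral Real.fourierChar volume (negDot d) (piFourier u) = u := by
  ext x
  have h := congrArg (fun f : 𝓢(EuclideanSpace ℝ (Fin d), ℂ) => f (WithLp.toLp 2 x))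
    (FourierTransform.fourierInv_fourier_eq (F := 𝓢(EuclideanSpace ℝ (Fin d), ℂ))
      (compCLMOfContinuousLinearEquiv ℂ (EuclideanSpace.equiv (Fin d) ℝ) u))
  simp only [fourierInv_coe, Real.fourierInv_eq] at h
  simp only [fourierIntegral, negDot_apply, neg_neg]
  refine Eq.trans ?_ h
  refine integral_congr_ae (.of_forall fun ξ => ?_)
  simp [piFourier, PiLp.inner_apply, mul_comm]

theorem fourierIntegral_neg_flip {d : ℕ} (u : 𝓢(Fin d → ℝ, ℂ)) :
    fourierIntegral Real.fourierChar volume (-(negDot d).flip) u = piFourier u := by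
  ext ξ
  simp only [piFourier, fourier_coe, Real.fourier_eq, fourierIntegral]
  rw [← (PiLp.volume_preserving_ofLp (Fin d)).integral_comp
    (MeasurableEquiv.toLp 2 (Fin d → ℝ)).symm.measurableEmbedding]
  refine integral_congr_ae (.of_forall fun x => ?_)
  simp [PiLp.inner_apply, negDot_apply]
  rfl

theorem integral_conv_eq_fourierIntegral {d : ℕ} {a : (Fin d → ℝ) → ℂ} (ha : Integrable a)
    (u : 𝓢(Fin d → ℝ, ℂ)) (x : Fin d → ℝ) :
    ∫ y, a (x - y) * u y = fourierIntegral Real.fourierChar volume (negDot d)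
      (fun ξ => fourierIntegral Real.fourierChar volume (-(negDot d).flip) a ξ * piFourier u ξ)
      x := by
  have hg : Integrable (fun ξ => Real.fourierChar (-negDot d ξ x) • piFourier u ξ) :=
    (fourierIntegral_convergent_iff Real.continuous_fourierChar (continuous_negDot d) x).2
      (piFourier u).integrable
  have h := integral_fourierIntegral_smul_eq_flip (μ := (volume : Measure (Fin d → ℝ)))
    Real.continuous_fourierChar (continuous_neg_flip_negDot d) ha hg
  rw [← integral_sub_left_eq_self (fun y => a (x - y) * u y) volume x]
  simp only [sub_sub_cancel]
  refine (Eq.trans ?_ h.symm).trans ?_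
  · refine integral_congr_ae (.of_forall fun z => ?_)
    rw [← fourierIntegral_piFourier u]
    simp only [smul_eq_mul, fourierIntegral]
    congr 1
    refine integral_congr_ae (.of_forall fun ξ => ?_)
    simp only [smul_smul, ← AddChar.map_add_eq_mul]
    congr 2
    simp only [map_sub, LinearMap.flip_apply, LinearMap.neg_apply]
    ring
  · refine integral_congr_ae (.of_forall fun ξ => ?_)
    simp only [Circle.smul_def, smul_eq_mul]
    ring

theorem integrable_symbol_mul {d : ℕ} {a : (Fin d → ℝ) → ℂ} (ha : Integrable a)
    {g : EuclideanSpace ℝ (Fin d) → ℂ} (hg : Integrable g) :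
    Integrable (fun ξ =>
      fourierIntegral Real.fourierChar volume (-(negDot d).flip) a ξ * g ξ) :=
  hg.bdd_mul (fourierIntegral_continuous Real.continuous_fourierChar
    (continuous_neg_flip_negDot d) ha).aestronglyMeasurable
    (.of_forall fun _ => norm_fourierIntegral_le_integral_norm _ _ _ _ _)

open ComplexConjugate in
theorem integral_conj_conv_mul {d : ℕ} {a : (Fin d → ℝ) → ℂ} (ha : Integrable a)
    (u : 𝓢(Fin d → ℝ, ℂ)) :
    ∫ x, conj (∫ y, a (x - y) * u y) * u x =
      ∫ ξ, conj (fourierIntegral Real.fourierChar volume (-(negDot d).flip) a ξ *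
        piFourier u ξ) * piFourier u ξ := by
  have h := integral_sesq_fourierIntegral_eq_neg_flip (innerSL ℂ) Real.continuous_fourierChar
    (continuous_negDot d) (integrable_symbol_mul ha (piFourier u).integrable)
    (u.integrable (μ := volume))
  simp only [fourierIntegral_neg_flip, innerSL_apply_apply, RCLike.inner_apply] at h
  simp only [integral_conv_eq_fourierIntegral ha]
  simpa only [mul_comm] using h

open ComplexConjugate in
theorem integral_conj_mul_self {d : ℕ} (u : 𝓢(Fin d → ℝ, ℂ)) :
    ∫ x, conj (u x) * u x = ∫ ξ, conj (piFourier u ξ) * piFourier u ξ := by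
  have h := integral_sesq_fourierIntegral_eq_neg_flip (innerSL ℂ) Real.continuous_fourierChar
    (continuous_negDot d) ((piFourier u).integrable (μ := volume)) (u.integrable (μ := volume))
  simp only [fourierIntegral_neg_flip, fourierIntegral_piFourier, innerSL_apply_apply,
    RCLike.inner_apply] at h
  simpa only [mul_comm] using h

open ComplexOrder in
/-- A convolution operator whose symbol is real and bounded below by `m` is bounded below by `m`. -/
theorem isPositive_sub_of_le_symbol {d : ℕ} {a : (Fin d → ℝ) → ℂ} (ha : Integrable a)
    {hatA : (Fin d → ℝ) → ℝ}
    (hA : ∀ ξ, (hatA ξ : ℂ) = ∫ x, Complex.exp (-Complex.I * (∑ i, ξ i * x i)) * a x)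
    {m : ℝ} (hm : ∀ ξ, m ≤ hatA ξ)
    (A : Lp ℂ 2 (volume : Measure (Fin d → ℝ)) →L[ℂ] Lp ℂ 2 (volume : Measure (Fin d → ℝ)))
    (hAu : ∀ u : Lp ℂ 2 (volume : Measure (Fin d → ℝ)),
      (A u : (Fin d → ℝ) → ℂ) =ᵐ[volume] fun x => ∫ y, a (x - y) * u y) :
    (A - (m : ℂ) • 1).IsPositive := by
  have hsymb : ∀ ξ : EuclideanSpace ℝ (Fin d),
      fourierIntegral Real.fourierChar volume (-(negDot d).flip) a ξ =
        (hatA fun i => 2 * Real.pi * ξ i : ℝ) := by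
    intro ξ
    rw [hA, fourierIntegral]
    refine integral_congr_ae (.of_forall fun x => ?_)
    simp only [Circle.smul_def, smul_eq_mul, Real.fourierChar_apply, LinearMap.neg_apply,
      LinearMap.flip_apply, negDot_apply, neg_neg]
    congr 2
    push_cast
    simp only [mul_assoc, ← Finset.mul_sum]
    ring
  rw [ContinuousLinearMap.isPositive_iff_complex]
  have hnn : ∀ x, 0 ≤ inner ℂ ((A - (m : ℂ) • 1) x) x := by
    intro x
    refine (SchwartzMap.denseRange_toLpCLM (E := Fin d → ℝ) (F := ℂ) (μ := volume) (p := 2)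
      ENNReal.ofNat_ne_top).induction_on (p := fun x => 0 ≤ inner ℂ ((A - (m : ℂ) • 1) x) x) x
      (isClosed_le continuous_const (by fun_prop)) fun u => ?_
    have hu := u.coeFn_toLp 2 (volume : Measure (Fin d → ℝ))
    set U := u.toLp 2 (volume : Measure (Fin d → ℝ)) with hU
    change 0 ≤ inner ℂ ((A - (m : ℂ) • 1) U) U
    have h1 : inner ℂ (A U) U =
        ∫ x, starRingEnd ℂ (∫ y, a (x - y) * u y) * u x := by
      rw [L2.inner_def]
      refine integral_congr_ae ?_
      filter_upwards [hAu U, hu] with x hx hx2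
      rw [hx, hx2, RCLike.inner_apply, mul_comm]
      congr 2
      refine integral_congr_ae ?_
      filter_upwards [hu] with y hy
      rw [hy]
    have h2 : inner ℂ U U = ∫ x, starRingEnd ℂ (u x) * u x := by
      rw [L2.inner_def]
      refine integral_congr_ae ?_
      filter_upwards [hu] with x hx
      rw [hx, RCLike.inner_apply, mul_comm]
    have hgg : Integrable fun ξ => starRingEnd ℂ (piFourier u ξ) * piFourier u ξ := by
      have := L2.integrable_inner (𝕜 := ℂ) ((piFourier u).toLp 2 volume)
        ((piFourier u).toLp 2 volume)
      refine this.congr ?_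
      filter_upwards [(piFourier u).coeFn_toLp 2 volume] with ξ hξ
      rw [hξ, RCLike.inner_apply, mul_comm]
    have hagg := integrable_symbol_mul ha hgg
    have h3 : (A - (m : ℂ) • 1) U = A U - (m : ℂ) • U := rfl
    rw [h3, inner_sub_left, inner_smul_left, Complex.conj_ofReal, h1, h2,
      integral_conj_conv_mul ha, integral_conj_mul_self, ← integral_const_mul, ← integral_sub]
    · have h4 : ∀ ξ, starRingEnd ℂ (fourierIntegral Real.fourierChar volume (-(negDot d).flip) a ξ *
          piFourier u ξ) * piFourier u ξ - m * (starRingEnd ℂ (piFourier u ξ) * piFourier u ξ) =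
          (((hatA fun i => 2 * Real.pi * ξ i) - m) * ‖piFourier u ξ‖ ^ 2 : ℝ) := by
        intro ξ
        rw [hsymb, map_mul, Complex.conj_ofReal, mul_assoc, Complex.conj_mul']
        push_cast
        ring
      simp only [h4]
      rw [integral_complex_ofReal]
      exact_mod_cast integral_nonneg fun ξ => mul_nonneg (sub_nonneg.2 (hm _)) (sq_nonneg _)
    · refine hagg.congr (.of_forall fun ξ => ?_)
      simp only [hsymb, map_mul, Complex.conj_ofReal, mul_assoc]
    · exact hgg.const_mul _
  intro x
  obtain ⟨h1, h2⟩ := Complex.nonneg_iff.1 (hnn x)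
  exact ⟨Complex.ext rfl h2, h1⟩

end Fourier

section Young

variable {G : Type*} [AddCommGroup G] [MeasurableSpace G] [MeasurableAdd₂ G] [MeasurableNeg G]
  {μ : Measure G} [SFinite μ] [μ.IsAddLeftInvariant]

theorem aestronglyMeasurable_sub_mul {a w : G → ℂ} (ha : AEStronglyMeasurable a μ)
    (hw : AEStronglyMeasurable w μ) :
    AEStronglyMeasurable (fun p : G × G => a (p.1 - p.2) * w p.2) (μ.prod μ) :=
  (ha.comp_quasiMeasurePreserving (quasiMeasurePreserving_sub_of_right_invariant μ μ)).mul
    hw.comp_snd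

theorem aestronglyMeasurable_integral_sub_mul {a w : G → ℂ} (ha : AEStronglyMeasurable a μ)
    (hw : AEStronglyMeasurable w μ) :
    AEStronglyMeasurable (fun x => ∫ y, a (x - y) * w y ∂μ) μ :=
  (aestronglyMeasurable_sub_mul ha hw).integral_prod_right'

variable [μ.IsNegInvariant]

/-- **Young's convolution inequality** for `L¹ ⋆ L²`, in terms of nonnegative integrals. -/
theorem lintegral_sq_lintegral_sub_mul_le {f g : G → ENNReal} (hf : AEMeasurable f μ)
    (hg : AEMeasurable g μ) :
    ∫⁻ x, (∫⁻ y, f (x - y) * g y ∂μ) ^ 2 ∂μ ≤ (∫⁻ y, f y ∂μ) ^ 2 * ∫⁻ y, g y ^ 2 ∂μ := by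
  have hfx : ∀ x, AEMeasurable (fun y => f (x - y)) μ := fun x =>
    hf.comp_quasiMeasurePreserving (quasiMeasurePreserving_sub_left μ x)
  have hfp : AEMeasurable (fun p : G × G => f (p.1 - p.2)) (μ.prod μ) :=
    hf.comp_quasiMeasurePreserving (quasiMeasurePreserving_sub_of_right_invariant μ μ)
  have hcs : ∀ x, (∫⁻ y, f (x - y) * g y ∂μ) ^ 2 ≤
      (∫⁻ y, f y ∂μ) * ∫⁻ y, f (x - y) * g y ^ 2 ∂μ := by
    intro x
    have h := ENNReal.lintegral_mul_le_Lp_mul_Lq μ Real.HolderConjugate.two_two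
      (f := fun y => f (x - y) ^ (1 / 2 : ℝ)) (g := fun y => f (x - y) ^ (1 / 2 : ℝ) * g y)
      ((hfx x).pow_const _) (((hfx x).pow_const _).mul hg)
    have hsq : ∀ t : ENNReal, (t ^ (1 / 2 : ℝ)) ^ (2 : ℝ) = t := fun t => by
      rw [← ENNReal.rpow_mul]; norm_num
    have hmul : ∀ t : ENNReal, t ^ (1 / 2 : ℝ) * t ^ (1 / 2 : ℝ) = t := fun t => by
      rw [← pow_two, ← ENNReal.rpow_natCast]; exact_mod_cast hsq t
    simp only [Pi.mul_apply, ← mul_assoc, hmul,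
      ENNReal.mul_rpow_of_nonneg _ _ (zero_le_two : (0 : ℝ) ≤ 2), hsq] at h
    rw [lintegral_sub_left_eq_self (fun y => f y)] at h
    calc _ ≤ _ := pow_le_pow_left' h 2
      _ = _ := by
        rw [mul_pow]
        simp only [← ENNReal.rpow_natCast, Nat.cast_ofNat, hsq]
  calc _ ≤ ∫⁻ x, (∫⁻ y, f y ∂μ) * ∫⁻ y, f (x - y) * g y ^ 2 ∂μ ∂μ := lintegral_mono hcs
    _ = (∫⁻ y, f y ∂μ) * ∫⁻ x, ∫⁻ y, f (x - y) * g y ^ 2 ∂μ ∂μ :=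
      lintegral_const_mul'' _ (hfp.mul (hg.pow_const 2).comp_snd).lintegral_prod_right'
    _ = (∫⁻ y, f y ∂μ) * ∫⁻ y, ∫⁻ x, f (x - y) * g y ^ 2 ∂μ ∂μ := by
      rw [lintegral_lintegral_swap]
      exact hfp.mul (hg.pow_const 2).comp_snd
    _ = (∫⁻ y, f y ∂μ) * ∫⁻ y, (∫⁻ x, f x ∂μ) * g y ^ 2 ∂μ := by
      congr 2 with y
      rw [lintegral_mul_const'', lintegral_sub_right_eq_self f]
      exact hf.comp_quasiMeasurePreserving
        (measurePreserving_sub_right μ y).quasiMeasurePreserving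
    _ = _ := by
      rw [lintegral_const_mul'' _ (hg.pow_const 2), ← mul_assoc, ← pow_two]

theorem eLpNorm_two_sq {α : Type*} [MeasurableSpace α] {ν : Measure α} (f : α → ℂ) :
    eLpNorm f 2 ν ^ 2 = ∫⁻ x, ‖f x‖ₑ ^ 2 ∂ν := by
  have := eLpNorm_nnreal_pow_eq_lintegral (μ := ν) (f := f) (p := 2) two_ne_zero
  simpa only [NNReal.coe_ofNat, ENNReal.rpow_ofNat, ENNReal.coe_ofNat] using this

theorem lintegral_sq_lintegral_enorm_sub_mul_le {a w : G → ℂ} (ha : AEStronglyMeasurable a μ)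
    (hw : AEStronglyMeasurable w μ) :
    ∫⁻ x, (∫⁻ y, ‖a (x - y) * w y‖ₑ ∂μ) ^ 2 ∂μ ≤ ((∫⁻ y, ‖a y‖ₑ ∂μ) * eLpNorm w 2 μ) ^ 2 := by
  rw [mul_pow, eLpNorm_two_sq]
  simp only [enorm_mul]
  exact lintegral_sq_lintegral_sub_mul_le ha.enorm hw.enorm

theorem ae_integrable_sub_mul_s11 {a w : G → ℂ} (ha : Integrable a μ) (hw : MemLp w 2 μ) :
    ∀ᵐ x ∂μ, Integrable (fun y => a (x - y) * w y) μ := by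
  have hmeas := aestronglyMeasurable_sub_mul ha.1 hw.1
  have hfin : ∫⁻ x, (∫⁻ y, ‖a (x - y) * w y‖ₑ ∂μ) ^ 2 ∂μ ≠ ⊤ :=
    ((lintegral_sq_lintegral_enorm_sub_mul_le ha.1 hw.1).trans_lt
      (ENNReal.pow_lt_top (ENNReal.mul_lt_top ha.2 hw.2))).ne
  filter_upwards [ae_lt_top' (hmeas.enorm.lintegral_prod_right'.pow_const 2) hfin] with x hx
  refine ⟨?_, by rw [HasFiniteIntegral]; simpa using hx⟩
  exact (ha.1.comp_quasiMeasurePreserving (quasiMeasurePreserving_sub_left μ x)).mul hw.1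

/-- **Young's convolution inequality** for `L¹ ⋆ L²`. -/
theorem eLpNorm_integral_sub_mul_le {a w : G → ℂ} (ha : AEStronglyMeasurable a μ)
    (hw : AEStronglyMeasurable w μ) :
    eLpNorm (fun x => ∫ y, a (x - y) * w y ∂μ) 2 μ ≤ (∫⁻ y, ‖a y‖ₑ ∂μ) * eLpNorm w 2 μ := by
  rw [← ENNReal.pow_le_pow_left_iff two_ne_zero, eLpNorm_two_sq]
  refine le_trans (lintegral_mono fun x => ?_) (lintegral_sq_lintegral_enorm_sub_mul_le ha hw)
  exact pow_le_pow_left' (enorm_integral_le_lintegral_enorm _) 2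

end Young

theorem exists_mul_continuousLinearMap {α : Type*} [MeasurableSpace α] {μ : Measure α}
    {f : α → ℂ} (hf : MemLp f ⊤ μ) :
    ∃ M : Lp ℂ 2 μ →L[ℂ] Lp ℂ 2 μ, ∀ u, M u =ᵐ[μ] fun x => f x * u x := by
  refine ⟨(ContinuousLinearMap.mul ℂ ℂ).holderL μ ⊤ 2 2 hf.toLp, fun u => ?_⟩
  refine ((ContinuousLinearMap.mul ℂ ℂ).coeFn_holder hf.toLp u).trans ?_
  filter_upwards [hf.coeFn_toLp] with x hx
  rw [hx]
  rfl

theorem opNorm_le_of_ae_bound {α : Type*} [MeasurableSpace α] {μ : Measure α} {f : α → ℂ}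
    {c : ℝ} (hc : 0 ≤ c) (hf : ∀ᵐ x ∂μ, ‖f x‖ ≤ c)
    (M : Lp ℂ 2 μ →L[ℂ] Lp ℂ 2 μ) (hM : ∀ u, M u =ᵐ[μ] fun x => f x * u x) : ‖M‖ ≤ c := by
  refine M.opNorm_le_bound hc fun u => Lp.norm_le_mul_norm_of_ae_le_mul ?_
  filter_upwards [hM u, hf] with x hx hfx
  rw [hx, norm_mul]
  gcongr

theorem opNorm_le_integral_norm {G : Type*} [AddCommGroup G] [MeasurableSpace G]
    [MeasurableAdd₂ G] [MeasurableNeg G] {μ : Measure G} [SFinite μ] [μ.IsAddLeftInvariant]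
    [μ.IsNegInvariant] {a : G → ℂ} (ha : Integrable a μ) (A : Lp ℂ 2 μ →L[ℂ] Lp ℂ 2 μ)
    (hA : ∀ u, A u =ᵐ[μ] fun x => ∫ y, a (x - y) * u y ∂μ) : ‖A‖ ≤ ∫ x, ‖a x‖ ∂μ := by
  refine A.opNorm_le_bound (by positivity) fun u => ?_
  rw [integral_norm_eq_lintegral_enorm ha.1, Lp.norm_def, Lp.norm_def, ← ENNReal.toReal_mul,
    eLpNorm_congr_ae (hA u)]
  exact ENNReal.toReal_mono (ENNReal.mul_lt_top ha.2 (Lp.memLp u).2).ne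
    (eLpNorm_integral_sub_mul_le ha.1 (Lp.aestronglyMeasurable u))

theorem exists_convolution_continuousLinearMap {G : Type*} [AddCommGroup G] [MeasurableSpace G]
    [MeasurableAdd₂ G] [MeasurableNeg G] {μ : Measure G} [SFinite μ] [μ.IsAddLeftInvariant]
    [μ.IsNegInvariant] {a : G → ℂ} (ha : Integrable a μ) :
    ∃ A : Lp ℂ 2 μ →L[ℂ] Lp ℂ 2 μ, ∀ u, A u =ᵐ[μ] fun x => ∫ y, a (x - y) * u y ∂μ := by
  have hmem : ∀ u : Lp ℂ 2 μ, MemLp (fun x => ∫ y, a (x - y) * u y ∂μ) 2 μ := fun u =>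
    ⟨aestronglyMeasurable_integral_sub_mul ha.1 (Lp.aestronglyMeasurable u),
      (eLpNorm_integral_sub_mul_le ha.1 (Lp.aestronglyMeasurable u)).trans_lt
        (ENNReal.mul_lt_top ha.2 (Lp.memLp u).2)⟩
  let L : Lp ℂ 2 μ →ₗ[ℂ] Lp ℂ 2 μ :=
    { toFun := fun u => (hmem u).toLp
      map_add' := fun u v => by
        refine Lp.ext ((hmem (u + v)).coeFn_toLp.trans ?_)
        filter_upwards [Lp.coeFn_add (hmem u).toLp (hmem v).toLp, (hmem u).coeFn_toLp,
          (hmem v).coeFn_toLp, ae_integrable_sub_mul_s11 ha (Lp.memLp u),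
          ae_integrable_sub_mul_s11 ha (Lp.memLp v)] with x h hu hv hiu hiv
        rw [h, Pi.add_apply, hu, hv, ← integral_add hiu hiv]
        refine integral_congr_ae ?_
        filter_upwards [Lp.coeFn_add u v] with y hy
        rw [hy, Pi.add_apply, mul_add]
      map_smul' := fun c u => by
        refine Lp.ext ((hmem (c • u)).coeFn_toLp.trans ?_)
        filter_upwards [Lp.coeFn_smul c (hmem u).toLp, (hmem u).coeFn_toLp] with x h hu
        rw [RingHom.id_apply, h, Pi.smul_apply, hu, ← integral_smul]
        refine integral_congr_ae ?_
        filter_upwards [Lp.coeFn_smul c u] with y hy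
        rw [hy, Pi.smul_apply, smul_eq_mul, smul_eq_mul, mul_left_comm] }
  refine ⟨L.mkContinuous (∫ x, ‖a x‖ ∂μ) fun u => ?_, fun u => (hmem u).coeFn_toLp⟩
  rw [integral_norm_eq_lintegral_enorm ha.1, Lp.norm_def, Lp.norm_def, ← ENNReal.toReal_mul,
    show L u = (hmem u).toLp from rfl, eLpNorm_congr_ae (hmem u).coeFn_toLp]
  exact ENNReal.toReal_mono (ENNReal.mul_lt_top ha.2 (Lp.memLp u).2).ne
    (eLpNorm_integral_sub_mul_le ha.1 (Lp.aestronglyMeasurable u))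

theorem exists_simpleFunc_dist_lt {X : Type*} [PseudoMetricSpace X] [MeasurableSpace X]
    [OpensMeasurableSpace X] [TopologicalSpace.SeparableSpace X] {S : Set X} (hS : IsCompact S)
    {δ : ℝ} (hδ : 0 < δ) : ∃ s : SimpleFunc X X, ∀ x ∈ S, dist (s x) x < δ := by
  rcases isEmpty_or_nonempty X with hX | hX
  · exact ⟨SimpleFunc.ofIsEmpty, fun x => hX.elim x⟩
  let e := TopologicalSpace.denseSeq X
  obtain ⟨t, ht⟩ := hS.elim_finite_subcover (fun k => Metric.ball (e k) δ)
    (fun _ => Metric.isOpen_ball) (fun x _ => by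
      obtain ⟨k, hk⟩ := (TopologicalSpace.denseRange_denseSeq X).exists_dist_lt x hδ
      exact Set.mem_iUnion.2 ⟨k, hk⟩)
  refine ⟨SimpleFunc.nearestPt e (t.sup id), fun x hx => ?_⟩
  obtain ⟨k, hk, hxk⟩ := Set.mem_iUnion₂.1 (ht hx)
  have h := SimpleFunc.edist_nearestPt_le e x (Finset.le_sup (f := id) hk)
  rw [edist_dist, edist_dist, ENNReal.ofReal_le_ofReal_iff dist_nonneg] at h
  exact h.trans_lt (by rw [dist_comm]; exact hxk)

/-- An operator into `L²` of the form `u ↦ (x ↦ 1_S(x) ⟪k x, u⟫)` with `S` compact and `k`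
uniformly continuous is compact. -/
theorem isCompactOperator_of_ae_eq_indicator_inner {X H : Type*} [PseudoMetricSpace X]
    [MeasurableSpace X] [OpensMeasurableSpace X] [TopologicalSpace.SeparableSpace X]
    [NormedAddCommGroup H] [InnerProductSpace ℂ H] {μ : Measure X}
    {S : Set X} (hS : IsCompact S) (hSm : MeasurableSet S) (hμ : μ S ≠ ⊤) {k : X → H}
    (hk : UniformContinuous k) (P : H →L[ℂ] Lp ℂ 2 μ)
    (hP : ∀ u, P u =ᵐ[μ] S.indicator fun x => inner ℂ (k x) u) : IsCompactOperator P := by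
  let D : Lp ℂ 2 μ := indicatorConstLp 2 hSm hμ (1 : ℂ)
  refine (isClosed_setOfPred_isCompactOperator (𝕜₁ := ℂ) (𝕜₂ := ℂ)
    (σ₁₂ := RingHom.id ℂ) (M₁ := H) (M₂ := Lp ℂ 2 μ)).closure_subset
    (Metric.mem_closure_iff.2 fun η hη => ?_)
  have hη' : 0 < η / (2 * (‖D‖ + 1)) := by positivity
  obtain ⟨δ, hδ, hkδ⟩ := Metric.uniformContinuous_iff.1 hk _ hη'
  obtain ⟨s, hs⟩ := exists_simpleFunc_dist_lt hS hδ
  have hm : ∀ z, MeasurableSet (S ∩ s ⁻¹' {z}) := fun z => hSm.inter (s.measurableSet_fiber z)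
  have hf : ∀ z, μ (S ∩ s ⁻¹' {z}) ≠ ⊤ := fun z => measure_ne_top_of_subset Set.inter_subset_left hμ
  let F : H →L[ℂ] Lp ℂ 2 μ := ∑ z ∈ s.range,
    (innerSL ℂ (k z)).smulRight (indicatorConstLp 2 (hm z) (hf z) (1 : ℂ))
  have hFu : ∀ u, F u =ᵐ[μ] S.indicator fun x => inner ℂ (k (s x)) u := by
    intro u
    have h1 : F u = ∑ z ∈ s.range,
        (inner ℂ (k z) u : ℂ) • indicatorConstLp 2 (hm z) (hf z) (1 : ℂ) := by
      simp [F]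
    rw [h1]
    have h2 : ∀ᵐ x ∂μ, ∀ z ∈ s.range,
        ((inner ℂ (k z) u : ℂ) • indicatorConstLp 2 (hm z) (hf z) (1 : ℂ) : Lp ℂ 2 μ) x =
          (S ∩ s ⁻¹' {z}).indicator (fun _ => inner ℂ (k z) u) x := by
      refine (Filter.eventually_all_finset _).2 fun z _ => ?_
      filter_upwards [Lp.coeFn_smul (inner ℂ (k z) u : ℂ)
        (indicatorConstLp 2 (hm z) (hf z) (1 : ℂ)),
        indicatorConstLp_coeFn (p := 2) (hs := hm z) (hμs := hf z) (c := (1 : ℂ))] with x h h'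
      rw [h, Pi.smul_apply, h']
      by_cases hx : x ∈ S ∩ s ⁻¹' {z}
      · simp only [Set.indicator_of_mem hx, smul_eq_mul, mul_one]
      · simp only [Set.indicator_of_notMem hx, smul_eq_mul, mul_zero]
    filter_upwards [h2, Lp.coeFn_finsetSum s.range fun z =>
      (inner ℂ (k z) u : ℂ) • indicatorConstLp 2 (hm z) (hf z) (1 : ℂ)] with x hx hx'
    rw [hx', Finset.sum_apply, Finset.sum_congr rfl hx, Finset.sum_eq_single (s x)]
    · by_cases hxS : x ∈ S <;> simp [hxS]
    · intro z _ hz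
      exact Set.indicator_of_notMem (fun h => hz h.2.symm) _
    · intro h
      exact absurd (s.mem_range_self x) h
  refine ⟨F, ?_, ?_⟩
  · refine (compactOperator (RingHom.id ℂ) H (Lp ℂ 2 μ)).sum_mem fun z _ => ?_
    exact (isCompactOperator_of_locallyCompactSpace_rng (ContinuousLinearMap.toSpanSingleton ℂ
      (indicatorConstLp 2 (hm z) (hf z) (1 : ℂ)))).comp_clm (innerSL ℂ (k z))
  · rw [dist_eq_norm]
    refine ((P - F).opNorm_le_bound (M := η / 2) (by positivity) fun u => ?_).trans_lt (by linarith)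
    have : ‖(P - F) u‖ ≤ (η / (2 * (‖D‖ + 1)) * ‖u‖) * ‖D‖ := by
      refine Lp.norm_le_mul_norm_of_ae_le_mul ?_
      filter_upwards [hP u, hFu u, Lp.coeFn_sub (P u) (F u),
        indicatorConstLp_coeFn (p := 2) (hs := hSm) (hμs := hμ) (c := (1 : ℂ))] with x h1 h2 h3 h4
      rw [sub_apply, h3, Pi.sub_apply, h1, h2, h4]
      by_cases hx : x ∈ S
      · simp only [hx, Set.indicator_of_mem, ← inner_sub_left, norm_one, mul_one]
        refine (norm_inner_le_norm _ _).trans ?_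
        gcongr
        rw [← dist_eq_norm, dist_comm]
        exact (hkδ (hs x hx)).le
      · simp [hx]
    refine this.trans ?_
    have : η / (2 * (‖D‖ + 1)) * ‖D‖ ≤ η / 2 := by
      rw [div_mul_eq_mul_div, div_le_div_iff₀ (by positivity) two_pos]
      nlinarith [norm_nonneg D]
    nlinarith [norm_nonneg u]

section Compact

open scoped Pointwise

variable {E : Type*} [NormedAddCommGroup E] [ProperSpace E] [MeasurableSpace E] [BorelSpace E]
  {μ : Measure E} [μ.IsAddHaarMeasure]

theorem isCompactOperator_convolution_comp_mul_of_compactSupport {b W : E → ℂ}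
    (hb : Continuous b) (hbs : HasCompactSupport b) (hW : MemLp W 2 μ) {K : Set E}
    (hK : IsCompact K) (hWK : ∀ y ∉ K, W y = 0) (B N : Lp ℂ 2 μ →L[ℂ] Lp ℂ 2 μ)
    (hB : ∀ u, B u =ᵐ[μ] fun x => ∫ y, b (x - y) * u y ∂μ)
    (hN : ∀ u, N u =ᵐ[μ] fun x => W x * u x) : IsCompactOperator (B * N) := by
  have hS : IsCompact (K + tsupport b) := hK.add hbs
  obtain ⟨c, hc⟩ := hb.bounded_above_of_compact_support hbs
  have hmem : ∀ x, MemLp (fun y => star (b (x - y) * W y)) 2 μ := fun x =>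
    (hW.of_le_mul (c := c) ((hb.comp (continuous_const.sub continuous_id)).aestronglyMeasurable.mul
      hW.1) (Filter.Eventually.of_forall fun y =>
        (norm_mul_le _ _).trans (mul_le_mul_of_nonneg_right (hc _) (norm_nonneg _)))).star
  let k : E → Lp ℂ 2 μ := fun x => (hmem x).toLp
  have hk : UniformContinuous k := by
    rw [Metric.uniformContinuous_iff]
    intro η hη
    let w : Lp ℂ 2 μ := hW.toLp
    have hη' : 0 < η / (‖w‖ + 1) := by positivity
    obtain ⟨δ, hδ, h⟩ := Metric.uniformContinuous_iff.1
      (hbs.uniformContinuous_of_continuous hb) _ hη'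
    refine ⟨δ, hδ, fun {x z} hxz => ?_⟩
    rw [dist_eq_norm]
    have : ‖k x - k z‖ ≤ η / (‖w‖ + 1) * ‖w‖ := by
      refine Lp.norm_le_mul_norm_of_ae_le_mul ?_
      filter_upwards [Lp.coeFn_sub (k x) (k z), (hmem x).coeFn_toLp, (hmem z).coeFn_toLp,
        hW.coeFn_toLp] with y h1 h2 h3 h4
      rw [h1, Pi.sub_apply, h2, h3, h4, ← star_sub, norm_star, ← sub_mul, norm_mul]
      gcongr
      rw [← dist_eq_norm]
      exact (h (by rwa [dist_sub_right])).le
    refine this.trans_lt ?_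
    rw [div_mul_eq_mul_div, div_lt_iff₀ (by positivity)]
    linarith
  refine isCompactOperator_of_ae_eq_indicator_inner hS hS.measurableSet hS.measure_ne_top hk
    (B * N) fun u => ?_
  filter_upwards [hB (N u)] with x hx
  rw [mul_apply_eq_comp, hx]
  have h1 : ∫ y, b (x - y) * N u y ∂μ = ∫ y, b (x - y) * W y * u y ∂μ := by
    refine integral_congr_ae ?_
    filter_upwards [hN u] with y hy
    rw [hy, mul_assoc]
  rw [h1]
  by_cases hxS : x ∈ K + tsupport b
  · rw [Set.indicator_of_mem hxS, L2.inner_def]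
    refine integral_congr_ae ?_
    filter_upwards [(hmem x).coeFn_toLp] with y hy
    rw [hy, RCLike.inner_apply, starRingEnd_apply, star_star, mul_comm]
  · rw [Set.indicator_of_notMem hxS]
    refine integral_eq_zero_of_ae (Filter.Eventually.of_forall fun y => ?_)
    by_cases hy : y ∈ K
    · have : b (x - y) = 0 := by
        by_contra h
        exact hxS (Set.mem_add.2 ⟨y, hy, x - y, subset_tsupport b h, add_sub_cancel y x⟩)
      simp [this]
    · simp [hWK y hy]

/-- The composition of a convolution operator with `L¹` kernel and multiplication by a bounded
function vanishing at infinity is compact on `L²`. -/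
theorem isCompactOperator_convolution_comp_mul {a V : E → ℂ} (ha : Integrable a μ)
    (hV : AEStronglyMeasurable V μ) {c : ℝ} (hc : ∀ x, ‖V x‖ ≤ c)
    (hV0 : Filter.Tendsto V (Filter.cocompact E) (nhds 0)) (A M : Lp ℂ 2 μ →L[ℂ] Lp ℂ 2 μ)
    (hA : ∀ u, A u =ᵐ[μ] fun x => ∫ y, a (x - y) * u y ∂μ)
    (hM : ∀ u, M u =ᵐ[μ] fun x => V x * u x) : IsCompactOperator (A * M) := by
  have hc0 : 0 ≤ c := (norm_nonneg _).trans (hc 0)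
  refine (isClosed_setOfPred_isCompactOperator (𝕜₁ := ℂ) (𝕜₂ := ℂ)
    (σ₁₂ := RingHom.id ℂ) (M₁ := Lp ℂ 2 μ) (M₂ := Lp ℂ 2 μ)).closure_subset
    (Metric.mem_closure_iff.2 fun η hη => ?_)
  obtain ⟨b, hbs, hab, hb, hbi⟩ := ha.exists_hasCompactSupport_integral_sub_le
    (ε := η / (3 * (c + 1))) (by positivity)
  obtain ⟨B, hB⟩ := exists_convolution_continuousLinearMap hbi
  have hη' : 0 < η / (3 * (‖B‖ + 1)) := by positivity
  obtain ⟨K, hK, hKV⟩ := Filter.mem_cocompact.1 (hV0 (Metric.ball_mem_nhds 0 hη'))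
  have hWm : AEStronglyMeasurable (K.indicator V) μ := hV.indicator hK.measurableSet
  have hW2 : MemLp (K.indicator V) 2 μ := by
    refine (memLp_indicator_const 2 hK.measurableSet c (Or.inr hK.measure_ne_top)).of_le hWm
      (Filter.Eventually.of_forall fun x => ?_)
    by_cases hx : x ∈ K
    · simpa [hx] using (hc x).trans (le_abs_self c)
    · simp [hx]
  obtain ⟨N, hN⟩ := exists_mul_continuousLinearMap
    (memLp_top_of_bound hWm c (Filter.Eventually.of_forall fun x =>
      (norm_indicator_le_norm_self V x).trans (hc x)))
  refine ⟨B * N, isCompactOperator_convolution_comp_mul_of_compactSupport hb hbs hW2 hK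
    (fun y hy => Set.indicator_of_notMem hy V) B N hB hN, ?_⟩
  have hAB : ‖A - B‖ ≤ η / (3 * (c + 1)) := by
    refine (opNorm_le_integral_norm (ha.sub hbi) (A - B) fun u => ?_).trans hab
    filter_upwards [hA u, hB u, Lp.coeFn_sub (A u) (B u), ae_integrable_sub_mul_s11 ha (Lp.memLp u),
      ae_integrable_sub_mul_s11 hbi (Lp.memLp u)] with x h1 h2 h3 h4 h5
    rw [sub_apply, h3, Pi.sub_apply, h1, h2, ← integral_sub h4 h5]
    simp only [Pi.sub_apply, sub_mul]
  have hMc : ‖M‖ ≤ c := opNorm_le_of_ae_bound hc0 (Filter.Eventually.of_forall hc) M hM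
  have hMN : ‖M - N‖ ≤ η / (3 * (‖B‖ + 1)) := by
    refine opNorm_le_of_ae_bound (f := fun x => V x - K.indicator V x) hη'.le
      (Filter.Eventually.of_forall fun x => ?_) (M - N) fun u => ?_
    · by_cases hx : x ∈ K
      · simpa [hx] using hη'.le
      · have := hKV hx
        simp only [Set.mem_preimage, Metric.mem_ball, dist_zero_right] at this
        simpa [hx] using this.le
    · filter_upwards [hM u, hN u, Lp.coeFn_sub (M u) (N u)] with x h1 h2 h3
      rw [sub_apply, h3, Pi.sub_apply, h1, h2, sub_mul]
  rw [dist_eq_norm, show A * M - B * N = (A - B) * M + B * (M - N) by noncomm_ring]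
  have h1 : ‖(A - B) * M‖ ≤ η / 3 := by
    refine (norm_mul_le _ _).trans ((mul_le_mul hAB hMc (norm_nonneg _) (by positivity)).trans ?_)
    rw [div_mul_eq_mul_div, div_le_div_iff₀ (by positivity) (by positivity)]
    nlinarith
  have h2 : ‖B * (M - N)‖ ≤ η / 3 := by
    refine (norm_mul_le _ _).trans ((mul_le_mul_of_nonneg_left hMN (norm_nonneg _)).trans ?_)
    rw [mul_div_assoc', div_le_div_iff₀ (by positivity) (by positivity)]
    nlinarith [norm_nonneg B]
  calc _ ≤ _ := norm_add_le _ _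
    _ < η := by linarith

end Compact

theorem re_inner_indicatorConstLp_le {α : Type*} [MeasurableSpace α] {μ : Measure α} {Q : Set α}
    (hQ : MeasurableSet Q) (hμ : μ Q ≠ ⊤) (f : Lp ℂ 2 μ) {c : ℝ}
    (hf : ∀ᵐ x ∂μ, x ∈ Q → (f x).re ≤ c) :
    RCLike.re (inner ℂ f (indicatorConstLp 2 hQ hμ (1 : ℂ))) ≤
      c * ‖indicatorConstLp 2 hQ hμ (1 : ℂ)‖ ^ 2 := by
  have hn : ‖indicatorConstLp (μ := μ) 2 hQ hμ (1 : ℂ)‖ ^ 2 = μ.real Q := by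
    rw [norm_indicatorConstLp two_ne_zero ENNReal.ofNat_ne_top, norm_one, one_mul,
      ← Real.rpow_natCast, ← Real.rpow_mul measureReal_nonneg]
    norm_num
  have hi : IntegrableOn f Q μ := integrableOn_Lp_of_measure_ne_top f one_le_two hμ
  rw [hn, inner_re_symm, L2.inner_indicatorConstLp_one, ← integral_re hi]
  calc _ ≤ ∫ _ in Q, c ∂μ := setIntegral_mono_on_ae hi.re (integrableOn_const hμ) hQ hf
    _ = _ := by rw [setIntegral_const, smul_eq_mul, mul_comm]

theorem re_setIntegral_sub_le {d : ℕ} {a : (Fin d → ℝ) → ℂ} (ha : Integrable a) {x0 x : Fin d → ℝ}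
    {r c : ℝ} (hr : 0 ≤ r) (hac : ∀ z, ‖z‖ ≤ 2 * r → (a z).re ≤ c)
    (hx : x ∈ Metric.closedBall x0 r) :
    (∫ y in Metric.closedBall x0 r, a (x - y)).re ≤ (2 * r) ^ d * c := by
  have hi : IntegrableOn (fun y => a (x - y)) (Metric.closedBall x0 r) :=
    (ha.comp_sub_left x).integrableOn
  have hre : (∫ y in Metric.closedBall x0 r, a (x - y)).re =
      ∫ y in Metric.closedBall x0 r, (a (x - y)).re := (integral_re hi).symm
  rw [hre]
  calc _ ≤ ∫ _ in Metric.closedBall x0 r, c := by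
        refine setIntegral_mono_on hi.re
          (integrableOn_const (isCompact_closedBall x0 r).measure_ne_top)
          Metric.isClosed_closedBall.measurableSet fun y hy => hac _ ?_
        rw [← dist_eq_norm]
        linarith [dist_triangle_right x y x0, Metric.mem_closedBall.1 hx, Metric.mem_closedBall.1 hy]
    _ = _ := by
      rw [setIntegral_const, smul_eq_mul, Measure.real, Real.volume_pi_closedBall _ hr,
        ENNReal.toReal_ofReal (by positivity), Fintype.card_fin]

theorem exists_pos_lt_rpow_lt {d : ℕ} {α C c ρ : ℝ} (hα : (d : ℝ) < α) (hc : 0 < c) (hρ : 0 < ρ) :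
    ∃ r, 0 < r ∧ r < ρ ∧ C * r ^ α < (2 * r) ^ d * c := by
  have hlim : Filter.Tendsto (fun r : ℝ => C * r ^ (α - d)) (nhdsWithin 0 (Set.Ioi 0)) (nhds 0) := by
    have h := (Real.continuousAt_rpow_const 0 (α - d) (Or.inr (by linarith))).tendsto.const_mul C
    rw [Real.zero_rpow (by linarith), mul_zero] at h
    exact h.mono_left nhdsWithin_le_nhds
  obtain ⟨r, hr, hr0, hrρ⟩ := ((hlim.eventually_lt_const hc).and (Ioo_mem_nhdsGT hρ)).exists
  refine ⟨r, hr0, hrρ, ?_⟩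
  calc C * r ^ α = C * r ^ (α - d) * r ^ d := by
        rw [mul_assoc, ← Real.rpow_natCast, ← Real.rpow_add hr0, sub_add_cancel]
    _ < c * r ^ d := by gcongr
    _ ≤ (2 * r) ^ d * c := by
      rw [mul_comm]
      gcongr
      linarith

theorem exists_re_inner_lt {d : ℕ} {a : (Fin d → ℝ) → ℂ} {V : (Fin d → ℝ) → ℝ} {x0 : Fin d → ℝ}
    (ha : Integrable a) (hacont : ContinuousAt a 0) (ha0 : (a 0).re < 0) {α C ε : ℝ}
    (hα : (d : ℝ) < α) (hC : 0 < C) (hε : 0 < ε)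
    (hO : ∀ x, ‖x - x0‖ < ε → V x - V x0 ≤ C * ‖x - x0‖ ^ α)
    (T : Lp ℂ 2 (volume : Measure (Fin d → ℝ)) →L[ℂ] Lp ℂ 2 (volume : Measure (Fin d → ℝ)))
    (hT : ∀ u : Lp ℂ 2 (volume : Measure (Fin d → ℝ)),
      T u =ᵐ[volume] fun x => (∫ y, a (x - y) * u y) + (V x : ℂ) * u x) :
    ∃ φ, RCLike.re (inner ℂ (T φ) φ) < V x0 * ‖φ‖ ^ 2 := by
  have hev : ∀ᶠ z in nhds 0, (a z).re < (a 0).re / 2 :=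
    (Complex.continuous_re.continuousAt.comp hacont).eventually_lt_const (by
      simp only [Function.comp_apply]; linarith)
  obtain ⟨ρ, hρ, hρa⟩ := Metric.eventually_nhds_iff.1 hev
  obtain ⟨r, hr0, hrρ, hrC⟩ := exists_pos_lt_rpow_lt (C := C) hα
    (show 0 < -(a 0).re / 2 by linarith) (lt_min (half_pos hρ) hε)
  obtain ⟨hrρ, hrε⟩ := lt_min_iff.1 hrρ
  let Q := Metric.closedBall x0 r
  have hQ : MeasurableSet Q := Metric.isClosed_closedBall.measurableSet
  have hμ : volume Q ≠ ⊤ := (isCompact_closedBall x0 r).measure_ne_top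
  let φ : Lp ℂ 2 (volume : Measure (Fin d → ℝ)) := indicatorConstLp 2 hQ hμ 1
  have hφ : φ =ᵐ[volume] Q.indicator fun _ => 1 := indicatorConstLp_coeFn
  have hφ0 : 0 < ‖φ‖ := by
    rw [norm_indicatorConstLp two_ne_zero ENNReal.ofNat_ne_top, norm_one, one_mul]
    refine Real.rpow_pos_of_pos (ENNReal.toReal_pos ?_ hμ) _
    exact (Metric.measure_closedBall_pos volume x0 hr0).ne'
  refine ⟨φ, (re_inner_indicatorConstLp_le hQ hμ (T φ)
    (c := (2 * r) ^ d * ((a 0).re / 2) + (V x0 + C * r ^ α)) ?_).trans_lt ?_⟩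
  · filter_upwards [hT φ, hφ] with x hx hφx hxQ
    have hconv : ∫ y, a (x - y) * φ y = ∫ y in Q, a (x - y) := by
      rw [← integral_indicator hQ]
      refine integral_congr_ae ?_
      filter_upwards [hφ] with y hy
      by_cases hyQ : y ∈ Q <;> simp [hy, hyQ]
    have hxr : ‖x - x0‖ ≤ r := by
      rw [← dist_eq_norm]
      exact hxQ
    rw [hx, hφx, hconv, Set.indicator_of_mem hxQ, mul_one, Complex.add_re, Complex.ofReal_re]
    refine add_le_add (re_setIntegral_sub_le ha hr0.le (fun z hz => ?_) hxQ) ?_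
    · exact (hρa (by rw [dist_zero_right]; linarith)).le
    · have h1 := hO x (hxr.trans_lt hrε)
      have h2 : C * ‖x - x0‖ ^ α ≤ C * r ^ α := by
        have : 0 ≤ α := (Nat.cast_nonneg d).trans hα.le
        gcongr
      linarith
  · refine mul_lt_mul_of_pos_right ?_ (by positivity)
    linarith

theorem isPositive_sub_of_le_multiplier {α : Type*} [MeasurableSpace α] {μ : Measure α} {V : α → ℝ}
    {m : ℝ} (hm : ∀ x, m ≤ V x) (M : Lp ℂ 2 μ →L[ℂ] Lp ℂ 2 μ)
    (hM : ∀ u, M u =ᵐ[μ] fun x => (V x : ℂ) * u x) : (M - (m : ℂ) • 1).IsPositive := by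
  rw [ContinuousLinearMap.isPositive_iff_complex]
  intro u
  have h : inner ℂ ((M - (m : ℂ) • 1) u) u = ((∫ x, (V x - m) * ‖u x‖ ^ 2 ∂μ : ℝ) : ℂ) := by
    rw [L2.inner_def, ← integral_complex_ofReal]
    refine integral_congr_ae ?_
    filter_upwards [hM u, Lp.coeFn_sub (M u) ((m : ℂ) • u), Lp.coeFn_smul (m : ℂ) u]
      with x h1 h2 h3
    have h4 : ((M - (m : ℂ) • 1) u) x = ((V x - m : ℝ) : ℂ) * u x := by
      change (M u - (m : ℂ) • u : Lp ℂ 2 μ) x = _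
      rw [h2, Pi.sub_apply, h1, h3, Pi.smul_apply, smul_eq_mul, ← sub_mul]
      push_cast
      rfl
    rw [h4, RCLike.inner_apply, map_mul, Complex.conj_ofReal, mul_left_comm, RCLike.mul_conj]
    push_cast
    rfl
  rw [h]
  refine ⟨by simp, ?_⟩
  exact integral_nonneg fun x => mul_nonneg (sub_nonneg.2 (hm x)) (by positivity)

/-- If `a` is continuous at `0` with `Re a(0) < 0`, `V` attains its global minimum at
`x0` with `V_min ≤ a_min`, and `V(x) - V_min = O(|x-x0|^α)` near `x0` for some `α > d`,
then `ℒ = ℒ_{a⋆} + ℒ_V` has an eigenvalue strictly below `V_min`. -/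
theorem stmt_11 {d : ℕ} (hd : 0 < d) (a : (Fin d → ℝ) → ℂ) (V : (Fin d → ℝ) → ℝ)
    (hatA : (Fin d → ℝ) → ℝ) (x0 : Fin d → ℝ)
    (ha : Integrable a)
    (hsym : ∀ᵐ x ∂(volume : Measure (Fin d → ℝ)), a (-x) = starRingEnd ℂ (a x))
    (hacont : ContinuousAt a 0) (ha0 : (a 0).re < 0)
    (hVcont : Continuous V)
    (hV0 : Filter.Tendsto V (Filter.cocompact _) (nhds 0))
    (hmin : ∀ x, V x0 ≤ V x)
    (hA : ∀ ξ, (hatA ξ : ℂ) = ∫ x, Complex.exp (-Complex.I * (∑ i, ξ i * x i)) * a x)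
    (hVa : ∀ ξ, V x0 ≤ hatA ξ)
    (α C ε : ℝ) (hα : (d : ℝ) < α) (hC : 0 < C) (hε : 0 < ε)
    (hO : ∀ x, ‖x - x0‖ < ε → V x - V x0 ≤ C * ‖x - x0‖ ^ α)
    (T : Lp ℂ 2 (volume : Measure (Fin d → ℝ)) →L[ℂ] Lp ℂ 2 (volume : Measure (Fin d → ℝ)))
    (hT : ∀ u : Lp ℂ 2 (volume : Measure (Fin d → ℝ)),
      (T u : (Fin d → ℝ) → ℂ) =ᵐ[volume] fun x => (∫ y, a (x - y) * u y) + (V x : ℂ) * u x) :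
    ∃ E : ℝ, E < V x0 ∧
      ∃ φ : Lp ℂ 2 (volume : Measure (Fin d → ℝ)), φ ≠ 0 ∧ T φ = (E : ℂ) • φ := by
  let E := Lp ℂ 2 (volume : Measure (Fin d → ℝ))
  obtain ⟨c, hc⟩ : ∃ c, ∀ x, ‖(V x : ℂ)‖ ≤ c := by
    let V' : ZeroAtInftyContinuousMap (Fin d → ℝ) ℝ := ⟨⟨V, hVcont⟩, hV0⟩
    exact ⟨‖V'.toBCF‖, fun x => (Complex.norm_real _).trans_le (V'.toBCF.norm_coe_le_norm x)⟩
  have hVc : Continuous fun x => (V x : ℂ) := Complex.continuous_ofReal.comp hVcont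
  obtain ⟨M, hM⟩ := exists_mul_continuousLinearMap (μ := volume)
    (memLp_top_of_bound hVc.aestronglyMeasurable c (Filter.Eventually.of_forall hc))
  have hAu : ∀ u : E, (T - M) u =ᵐ[volume] fun x => ∫ y, a (x - y) * u y := by
    intro u
    filter_upwards [hT u, hM u, Lp.coeFn_sub (T u) (M u)] with x h1 h2 h3
    rw [sub_apply, h3, Pi.sub_apply, h1, h2, add_sub_cancel_right]
  have hApos := isPositive_sub_of_le_symbol ha hA hVa (T - M) hAu
  have hMpos := isPositive_sub_of_le_multiplier hmin M hM
  have hcomp : IsCompactOperator ((T - M) * M) :=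
    isCompactOperator_convolution_comp_mul ha hVc.aestronglyMeasurable hc
      (by simpa [Function.comp_def] using (Complex.continuous_ofReal.tendsto 0).comp hV0)
      (T - M) M hAu hM
  have hm : V x0 ≤ 0 := by
    have : Nonempty (Fin d) := ⟨⟨0, hd⟩⟩
    exact ge_of_tendsto' hV0 hmin
  have hTsa : IsSelfAdjoint T := by
    have hc : IsSelfAdjoint ((V x0 : ℂ) • (1 : E →L[ℂ] E)) :=
      .smul (Complex.conj_ofReal _) (.one _)
    have h := (hApos.isSelfAdjoint.add hc).add (hMpos.isSelfAdjoint.add hc)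
    rwa [sub_add_cancel, sub_add_cancel, sub_add_cancel] at h
  obtain ⟨φ, hφ⟩ := exists_re_inner_lt ha hacont ha0 hα hC hε hO T hT
  obtain ⟨r, hr, hspec⟩ := exists_not_isUnit_sub_of_inner_lt T hTsa φ hφ
  obtain ⟨ψ, hψ, hTψ⟩ := exists_eigenvector_of_isCompactOperator_comp (T - M) M hm hApos hMpos hcomp
    hr (by rwa [sub_add_cancel])
  exact ⟨r, hr, ψ, hψ, by rwa [sub_add_cancel] at hTψ⟩
end
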